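/- arXiv:2006.09934 — 3 statements merged into one kernel-verified Lean document; each statement's English description precedes it below -/
import Mathlib

section
/- Let d ≥ 1 and let f_1, …, f_n : ℝ^d → [0,∞) be upper semi-continuous log-concave functions. For σ ⊆ {1,…,n} let f_σ(x) = min{f_i(x) : i ∈ σ}. Then there exists a subset σ ⊆ {1,…,n} with |σ| ≤ 3d+2 such that ∫_{ℝ^d} f_σ(x) dx ≤ (100 d)^{5d/2} · ∫_{ℝ^d} f_{{1,…,n}}(x) dx (an inequality of Lebesgue integrals in [0,∞]). -/
open MeasureTheory
open scoped BigOperators RealInnerProductSpace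

noncomputable section

/-- `ℝ^d` with the Euclidean structure. -/
abbrev Ed (d : ℕ) := EuclideanSpace ℝ (Fin d)

/-- `f : ℝ^d → [0,∞)` is log-concave, i.e. `f = e^{-ψ}` for some convex
`ψ : ℝ^d → ℝ ∪ {∞}`; equivalently, `f ≥ 0` and
`f(tx+(1-t)y) ≥ f(x)^t f(y)^{1-t}`. -/
def IsLogConcave {d : ℕ} (f : Ed d → ℝ) : Prop :=
  (∀ x, 0 ≤ f x) ∧
    ∀ x y : Ed d, ∀ t : ℝ, 0 ≤ t → t ≤ 1 →
      f x ^ t * f y ^ (1 - t) ≤ f (t • x + (1 - t) • y)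

/-- A proper log-concave function: log-concave, upper semicontinuous,
with positive finite integral. -/
def ProperLogConcave {d : ℕ} (f : Ed d → ℝ) : Prop :=
  IsLogConcave f ∧ UpperSemicontinuous f ∧
    0 < ∫⁻ x, ENNReal.ofReal (f x) ∧ (∫⁻ x, ENNReal.ofReal (f x)) < ⊤

/-- The `s`-lifting of `f`, a subset of `ℝ^d × ℝ = ℝ^{d+1}`. -/
def sLift {d : ℕ} (s : ℝ) (f : Ed d → ℝ) : Set (Ed d × ℝ) :=
  {p | |p.2| ≤ f p.1 ^ (1 / s)}

/-- The `d`-symmetric ellipsoid `(A⊕α)B^{d+1} + a` in `ℝ^{d+1} = ℝ^d × ℝ`. -/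
def ellE {d : ℕ} (A : Matrix (Fin d) (Fin d) ℝ) (α : ℝ) (a : Ed d) : Set (Ed d × ℝ) :=
  {p | ∃ y : Ed d, ∃ t : ℝ, ‖y‖ ^ 2 + t ^ 2 ≤ 1 ∧
        p.1 = Matrix.toEuclideanLin A y + a ∧ p.2 = α * t}

/-- The closed Euclidean unit ball `B^{d+1}` of `ℝ^{d+1} = ℝ^d × ℝ`. -/
def unitBallE (d : ℕ) : Set (Ed d × ℝ) := {p | ‖p.1‖ ^ 2 + p.2 ^ 2 ≤ 1}

/-- `κ_s = ∫_{B^d} (1-|x|²)^{s/2} dx`. -/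
def kappa (d : ℕ) (s : ℝ) : ℝ :=
  ∫ x in Metric.closedBall (0 : Ed d) 1, (1 - ‖x‖ ^ 2) ^ (s / 2)

/-- The `s`-volume of the ellipsoid represented by `(A⊕α, a)`:
`μ_s = κ_s α^s det A`. -/
def svol {d : ℕ} (s : ℝ) (A : Matrix (Fin d) (Fin d) ℝ) (α : ℝ) : ℝ :=
  kappa d s * α ^ s * A.det

/-- `(A, α, a)` represents the John `s`-ellipsoid of `f`: it is a d-symmetric
ellipsoid contained in the `s`-lifting of `f` of maximal `s`-volume. -/
def IsJohn {d : ℕ} (s : ℝ) (f : Ed d → ℝ)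
    (A : Matrix (Fin d) (Fin d) ℝ) (α : ℝ) (a : Ed d) : Prop :=
  A.PosDef ∧ 0 < α ∧ ellE A α a ⊆ sLift s f ∧
    ∀ (A' : Matrix (Fin d) (Fin d) ℝ) (α' : ℝ) (a' : Ed d),
      A'.PosDef → 0 < α' → ellE A' α' a' ⊆ sLift s f → svol s A' α' ≤ svol s A α

/-- The height function of the ellipsoid represented by `(A⊕α, a)`. -/
def heightFn {d : ℕ} (A : Matrix (Fin d) (Fin d) ℝ) (α : ℝ) (a : Ed d) (x : Ed d) : ℝ :=
  if ‖Matrix.toEuclideanLin A⁻¹ (x - a)‖ ≤ 1 then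
    α * Real.sqrt (1 - ‖Matrix.toEuclideanLin A⁻¹ (x - a)‖ ^ 2)
  else 0

/-- A point of `ℝ^d × ℝ` as a vector in `ℝ^{d+1}`. -/
def augVec {d : ℕ} (p : Ed d × ℝ) : Fin (d + 1) → ℝ :=
  Fin.snoc (fun i => p.1 i) p.2

/-- The block-diagonal matrix `A ⊕ α`. -/
def matAug {d : ℕ} (A : Matrix (Fin d) (Fin d) ℝ) (α : ℝ) :
    Matrix (Fin (d + 1)) (Fin (d + 1)) ℝ :=
  Matrix.of fun i j =>
    Fin.lastCases (Fin.lastCases α (fun _ => 0) j)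
      (fun i' => Fin.lastCases 0 (fun j' => A i' j') j) i

/-- The Frobenius norm of a real matrix. -/
def frobNorm {n : ℕ} (M : Matrix (Fin n) (Fin n) ℝ) : ℝ :=
  Real.sqrt (∑ i, ∑ j, M i j ^ 2)

/-- Asplund sum (sup-convolution) of two functions. -/
def asplund {d : ℕ} (f g : Ed d → ℝ) : Ed d → ℝ :=
  fun x => ⨆ y : Ed d, f y * g (x - y)

/-- Epi-product `(λ ∗ f)(x) = f(x/λ)^λ`. -/
def epiProd {d : ℕ} (l : ℝ) (f : Ed d → ℝ) : Ed d → ℝ :=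
  fun x => f (l⁻¹ • x) ^ l

/-- The flat ellipsoid function `α · χ_{A B^d + a}`. -/
def flatFn {d : ℕ} (A : Matrix (Fin d) (Fin d) ℝ) (α : ℝ) (a : Ed d) (x : Ed d) : ℝ :=
  if ‖Matrix.toEuclideanLin A⁻¹ (x - a)‖ ≤ 1 then α else 0

/-- The Gaussian density `G[(A⊕α, a)](x) = α e^{−|A^{-1}(x−a)|²}`. -/
def gaussFn {d : ℕ} (A : Matrix (Fin d) (Fin d) ℝ) (α : ℝ) (a : Ed d) (x : Ed d) : ℝ :=
  α * Real.exp (-‖Matrix.toEuclideanLin A⁻¹ (x - a)‖ ^ 2)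

/-- Operator (`ℓ₂ → ℓ₂`) norm of a matrix. -/
def opNorm {d : ℕ} (M : Matrix (Fin d) (Fin d) ℝ) : ℝ :=
  ‖Matrix.toEuclideanCLM (𝕜 := ℝ) M‖

open Module

section Geometry

variable {E : Type*}

/-- Contrapositive form of Helly's theorem. -/
theorem exists_helly_subfamily [AddCommGroup E] [Module ℝ E] [FiniteDimensional ℝ E]
    {ι : Type*} [Fintype ι] {S : ι → Set E} (hS : ∀ i, Convex ℝ (S i))
    (hempty : ∀ x, ∃ i, x ∉ S i) :
    ∃ I : Finset ι, I.Nonempty ∧ I.card ≤ finrank ℝ E + 1 ∧ ∀ x, ∃ i ∈ I, x ∉ S i := by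
  by_contra! hI
  obtain ⟨x, hx⟩ := Convex.helly_theorem' (𝕜 := ℝ) (F := S) (s := Finset.univ)
    (fun i _ => hS i) (fun I _ hcard => by
      rcases I.eq_empty_or_nonempty with rfl | hne
      · exact ⟨0, by simp⟩
      · obtain ⟨x, hx⟩ := hI I hne hcard
        exact ⟨x, by simpa using hx⟩)
  obtain ⟨i, hi⟩ := hempty x
  exact hi (by simpa using Set.mem_iInter₂.1 hx i (Finset.mem_univ i))

/-- A compact spanning set contains a basis in which all of its elements have coordinates in
`[-1, 1]`. -/
theorem IsCompact.exists_basis_abs_repr_le_one [NormedAddCommGroup E] [NormedSpace ℝ E]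
    [FiniteDimensional ℝ E] {W : Set E} (hW : IsCompact W) (hspan : Submodule.span ℝ W = ⊤) :
    ∃ b : Basis (Fin (finrank ℝ E)) ℝ E, (∀ i, b i ∈ W) ∧ ∀ w ∈ W, ∀ i, |b.repr w i| ≤ 1 := by
  let e' := Basis.ofSpan hspan.ge
  have he' : ∀ i, e' i ∈ W := fun i => Basis.ofSpan_subset hspan.ge ⟨i, rfl⟩
  have : Fintype _ := FiniteDimensional.fintypeBasisIndex e'
  let e : Basis (Fin (finrank ℝ E)) ℝ E :=
    e'.reindex (Fintype.equivFinOfCardEq (finrank_eq_card_basis e').symm)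
  have he : ∀ i, e i ∈ W := fun i => by simpa [e] using he' _
  have hcont : Continuous fun v : Fin (finrank ℝ E) → E => |e.det v| := by
    simp only [Basis.det_apply]
    refine (Continuous.matrix_det (continuous_matrix fun i j => ?_)).abs
    exact (e.coord i).continuous_of_finiteDimensional.comp (continuous_apply j)
  obtain ⟨v, hvW, hmax⟩ := (isCompact_univ_pi fun _ : Fin (finrank ℝ E) => hW).exists_isMaxOn
    ⟨e, fun i _ => he i⟩ hcont.continuousOn
  have hpos : 0 < |e.det v| := by
    have h := hmax (show (e : Fin (finrank ℝ E) → E) ∈ _ from fun i _ => he i)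
    simp only [Set.mem_ofPred_eq, e.det_self, abs_one] at h
    linarith
  have hdet : IsUnit (e.det v) := isUnit_iff_ne_zero.2 (abs_pos.1 hpos)
  obtain ⟨hli, hsp⟩ := (Basis.is_basis_iff_det e).2 hdet
  refine ⟨Basis.mk hli hsp.ge, fun i => by simpa using hvW i trivial, fun w hw i => ?_⟩
  have hupd := congrArg (fun g => g w) (e.det_smul_mk_coord_eq_det_update hli hsp.ge i)
  simp only [LinearMap.smul_apply, smul_eq_mul, Basis.coord_apply] at hupd
  have hle : |e.det (Function.update v i w)| ≤ |e.det v| := hmax fun j _ => by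
    rcases eq_or_ne j i with rfl | hj
    · simpa using hw
    · simpa [hj] using hvW j trivial
  have heq : e.det (Function.update v i w) = e.det v * (Basis.mk hli hsp.ge).repr w i := hupd.symm
  rw [heq, abs_mul] at hle
  exact le_of_mul_le_mul_left (by simpa using hle) hpos

theorem Convex.sum_smul_mem_of_zero_mem [AddCommGroup E] [Module ℝ E] {s : Set E}
    (hs : Convex ℝ s) (h0 : (0 : E) ∈ s) {ι : Type*} [Fintype ι] {w : ι → ℝ} {z : ι → E}
    (hw : ∀ i, 0 ≤ w i) (hw1 : ∑ i, w i ≤ 1) (hz : ∀ i, z i ∈ s) : ∑ i, w i • z i ∈ s := by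
  have h := hs.sum_mem (t := Finset.univ) (w := fun o : Option ι => o.elim (1 - ∑ i, w i) w)
    (z := fun o => o.elim 0 z) (fun o _ => by cases o <;> simp [hw, hw1])
    (by simp [Fintype.sum_option]) (fun o _ => by cases o <;> simp [h0, hz])
  simpa [Fintype.sum_option] using h

/-- A convex body has an interior point about which its asymmetry is at most `2d + 1`. -/
theorem exists_mem_interior_forall_sub_smul_mem [NormedAddCommGroup E] [NormedSpace ℝ E]
    [FiniteDimensional ℝ E] (hd : 1 ≤ finrank ℝ E) {L : Set E} (hL : Convex ℝ L)
    (hc : IsCompact L) (hint : (interior L).Nonempty) :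
    ∃ a ∈ interior L, ∀ x ∈ L, a - (2 * finrank ℝ E + 1 : ℝ)⁻¹ • (x - a) ∈ L := by
  obtain ⟨p, hp⟩ := hint
  have hpL : p ∈ L := interior_subset hp
  set W : Set E := (fun x => x + p) ⁻¹' L
  have hWconv : Convex ℝ W := hL.translate_preimage_left p
  have hWc : IsCompact W := (Homeomorph.addRight p).isCompact_preimage.2 hc
  have h0W : (0 : E) ∈ W := by simpa [W] using hpL
  have h0int : (0 : E) ∈ interior W := by
    have := (Homeomorph.addRight p).preimage_interior L
    change (0 : E) ∈ interior ((Homeomorph.addRight p) ⁻¹' L)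
    rw [← this]
    simpa using hp
  have hspan : Submodule.span ℝ W = ⊤ :=
    Submodule.eq_top_of_nonempty_interior' _
      ⟨0, interior_mono Submodule.subset_span h0int⟩
  obtain ⟨b, hbW, hb⟩ := hWc.exists_basis_abs_repr_le_one hspan
  set d : ℝ := (finrank ℝ E : ℝ) with hd_def
  have hd1 : 1 ≤ d := by rw [hd_def]; exact_mod_cast hd
  set c : E := ∑ i, (2 * d)⁻¹ • b i
  have key : ∀ w ∈ W, c - (2 * d + 1)⁻¹ • (w - c) ∈ W := by
    intro w hw
    have hrep : c - (2 * d + 1)⁻¹ • (w - c) =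
        ∑ i, ((2 * d + 1)⁻¹ * ((d + 1) / d - b.repr w i)) • b i := by
      conv_lhs => rw [← b.sum_repr w]
      simp only [c, ← Finset.sum_sub_distrib, Finset.smul_sum, smul_smul, ← sub_smul]
      refine Finset.sum_congr rfl fun i _ => ?_
      congr 1
      field_simp
      ring
    rw [hrep]
    refine hWconv.sum_smul_mem_of_zero_mem h0W (fun i => ?_) ?_ hbW
    · have h1 := (abs_le.1 (hb w hw i)).2
      have h2 : 1 ≤ (d + 1) / d := by rw [le_div_iff₀] <;> linarith
      exact mul_nonneg (by positivity) (by linarith)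
    · have hsum : ∑ i, ((d + 1) / d - b.repr w i) ≤ ∑ _i : Fin (finrank ℝ E), ((d + 1) / d + 1) :=
        Finset.sum_le_sum fun i _ => by linarith [(abs_le.1 (hb w hw i)).1]
      rw [← Finset.mul_sum, inv_mul_le_iff₀ (by positivity), mul_one]
      refine hsum.trans (le_of_eq ?_)
      rw [Finset.sum_const, Finset.card_univ, Fintype.card_fin, nsmul_eq_mul]
      change d * _ = _
      field_simp
      ring
  have hL' : ∀ x ∈ L, (c + p) - (2 * d + 1)⁻¹ • (x - (c + p)) ∈ L := by
    intro x hx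
    have h := key (x - p) (by simpa [W] using hx)
    have h' : c - (2 * d + 1)⁻¹ • (x - p - c) + p ∈ L := h
    convert h' using 1
    rw [show x - p - c = x - (c + p) by abel]
    abel
  refine ⟨c + p, ?_, hL'⟩
  have hcombo := hL.combo_interior_self_mem_interior hp (hL' p hpL)
    (a := (2 * d + 2)⁻¹) (b := (2 * d + 1) / (2 * d + 2)) (by positivity) (by positivity)
    (by field_simp; ring)
  convert hcombo using 1
  rw [smul_sub, smul_smul, show (2 * d + 1) / (2 * d + 2) * (2 * d + 1)⁻¹ = (2 * d + 2)⁻¹ by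
    field_simp, smul_sub]
  have : c + p = ((2 * d + 2)⁻¹ + (2 * d + 1) / (2 * d + 2)) • (c + p) := by
    rw [show (2 * d + 2)⁻¹ + (2 * d + 1) / (2 * d + 2) = 1 by field_simp; ring, one_smul]
  conv_lhs => rw [this, add_smul]
  abel

theorem exists_inner_le_one_of_notMem [NormedAddCommGroup E] [InnerProductSpace ℝ E]
    [CompleteSpace E] {C : Set E} (hC : Convex ℝ C) (hcl : IsClosed C) (h0 : (0 : E) ∈ C) {x : E}
    (hx : x ∉ C) : ∃ w : E, (∀ z ∈ C, ⟪w, z⟫ ≤ 1) ∧ 1 < ⟪w, x⟫ := by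
  obtain ⟨f, u, hfu, hux⟩ := geometric_hahn_banach_closed_point hC hcl hx
  have hu : 0 < u := by simpa using hfu 0 h0
  refine ⟨u⁻¹ • (InnerProductSpace.toDual ℝ E).symm f, fun z hz => ?_, ?_⟩
  · rw [real_inner_smul_left, InnerProductSpace.toDual_symm_apply, inv_mul_le_iff₀ hu, mul_one]
    exact (hfu z hz).le
  · rw [real_inner_smul_left, InnerProductSpace.toDual_symm_apply, lt_inv_mul_iff₀ hu, mul_one]
    exact hux

theorem isCompact_iUnion_inner_le_one [NormedAddCommGroup E] [InnerProductSpace ℝ E]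
    [FiniteDimensional ℝ E] {ι : Type*} [Finite ι] {C : ι → Set E}
    (h0 : (0 : E) ∈ interior (⋂ i, C i)) :
    IsCompact (⋃ i, {w : E | ∀ x ∈ C i, ⟪w, x⟫ ≤ 1}) := by
  refine isCompact_iUnion fun i => Metric.isCompact_of_isClosed_isBounded ?_ ?_
  · have : {w : E | ∀ x ∈ C i, ⟪w, x⟫ ≤ 1} = ⋂ x ∈ C i, {w | ⟪w, x⟫ ≤ 1} := by
      ext; simp
    rw [this]
    exact isClosed_biInter fun x _ => isClosed_le (by fun_prop) continuous_const
  · obtain ⟨r, hr, hball⟩ := Metric.nhds_basis_closedBall.mem_iff.1 (mem_interior_iff_mem_nhds.1 h0)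
    refine (Metric.isBounded_closedBall (x := (0 : E)) (r := r⁻¹)).subset fun w hw => ?_
    rcases eq_or_ne w 0 with rfl | hw0
    · simpa using hr.le
    have hn : 0 < ‖w‖ := norm_pos_iff.2 hw0
    have hmem : (r / ‖w‖) • w ∈ C i := by
      refine Set.mem_iInter.1 (hball ?_) i
      rw [mem_closedBall_zero_iff, norm_smul, Real.norm_of_nonneg (by positivity)]
      field_simp
      rfl
    have h := hw _ hmem
    rw [real_inner_smul_right, real_inner_self_eq_norm_sq] at h
    rw [mem_closedBall_zero_iff, ← one_div, le_div_iff₀ hr]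
    calc ‖w‖ * r = r / ‖w‖ * ‖w‖ ^ 2 := by field_simp
      _ ≤ 1 := h

theorem span_iUnion_inner_le_one [NormedAddCommGroup E] [InnerProductSpace ℝ E]
    [FiniteDimensional ℝ E] {ι : Type*} {C : ι → Set E} (hC : ∀ i, Convex ℝ (C i))
    (hcl : ∀ i, IsClosed (C i)) (h0 : ∀ i, (0 : E) ∈ C i) (hb : Bornology.IsBounded (⋂ i, C i)) :
    Submodule.span ℝ (⋃ i, {w : E | ∀ x ∈ C i, ⟪w, x⟫ ≤ 1}) = ⊤ := by
  rw [← Submodule.orthogonal_eq_bot_iff, Submodule.eq_bot_iff]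
  intro x hx
  by_contra hx0
  obtain ⟨R, hR⟩ := hb.subset_closedBall 0
  have hn : 0 < ‖x‖ := norm_pos_iff.2 hx0
  have hmem : ((|R| + 1) / ‖x‖) • x ∈ ⋂ i, C i := by
    refine Set.mem_iInter.2 fun i => by_contra fun hi => ?_
    obtain ⟨w, hw, hwx⟩ := exists_inner_le_one_of_notMem (hC i) (hcl i) (h0 i) hi
    have := (Submodule.mem_orthogonal _ _).1 hx w
      (Submodule.subset_span (Set.mem_iUnion.2 ⟨i, hw⟩))
    rw [real_inner_smul_right, this] at hwx
    linarith
  have h := hR hmem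
  rw [mem_closedBall_zero_iff, norm_smul, Real.norm_of_nonneg (by positivity),
    div_mul_cancel₀ _ hn.ne'] at h
  linarith [le_abs_self R]

/-- Sparse approximation of an intersection of convex sets whose asymmetry about the origin is at
most `l`. -/
theorem exists_subfamily_smul_mem [NormedAddCommGroup E] [InnerProductSpace ℝ E]
    [FiniteDimensional ℝ E] (hd : 1 ≤ finrank ℝ E) {ι : Type*} [Fintype ι]
    {C : ι → Set E} (hC : ∀ i, Convex ℝ (C i)) (hcl : ∀ i, IsClosed (C i))
    (h0 : (0 : E) ∈ interior (⋂ i, C i)) (hb : Bornology.IsBounded (⋂ i, C i))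
    {l : ℝ} (hl : 0 < l) (hsym : ∀ x ∈ ⋂ i, C i, -(l⁻¹ • x) ∈ ⋂ i, C i) :
    ∃ σ : Finset ι, σ.card ≤ 2 * finrank ℝ E + 1 ∧
      ∀ x, (∀ i ∈ σ, x ∈ C i) → ∀ i, (finrank ℝ E * (l + 2) : ℝ)⁻¹ • x ∈ C i := by
  classical
  have h0C : ∀ i, (0 : E) ∈ C i := Set.mem_iInter.1 (interior_subset h0)
  obtain ⟨b, hbW, hrepr⟩ := (isCompact_iUnion_inner_le_one h0).exists_basis_abs_repr_le_one
    (span_iUnion_inner_le_one hC hcl h0C hb)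
  simp only [Set.mem_iUnion, Set.mem_ofPred_eq] at hbW hrepr
  choose k hk using hbW
  set d : ℝ := (finrank ℝ E : ℝ) with hd_def
  have hd1 : 1 ≤ d := by rw [hd_def]; exact_mod_cast hd
  have hsum : ∀ x ∈ ⋂ i, C i, -(d * l) ≤ ∑ j, ⟪b j, x⟫ := by
    intro x hx
    have : ∀ j, -l ≤ ⟪b j, x⟫ := fun j => by
      have h := hk j _ (Set.mem_iInter.1 (hsym x hx) (k j))
      rw [inner_neg_right, real_inner_smul_right, ← mul_neg, inv_mul_le_iff₀ hl] at h
      linarith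
    calc -(d * l) = ∑ _j : Fin (finrank ℝ E), -l := by simp [hd_def]
      _ ≤ _ := Finset.sum_le_sum fun j _ => this j
  obtain ⟨I, -, hIcard, hI⟩ := exists_helly_subfamily
    (S := fun i => C i ∩ {x | ∑ j, ⟪b j, x⟫ < -(d * l)})
    (fun i => (hC i).inter <| by
      have : {x : E | ∑ j, ⟪b j, x⟫ < -(d * l)} = {x | ⟪∑ j, b j, x⟫ < -(d * l)} := by
        simp only [sum_inner]
      rw [this]
      exact convex_halfSpace_lt (innerSL ℝ (∑ j, b j)).isLinear _)
    (fun x => by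
      by_contra! h
      have hne : Nonempty ι := ⟨k ⟨0, hd⟩⟩
      exact (h hne.some).2.not_ge (hsum x (Set.mem_iInter.2 fun i => (h i).1)))
  refine ⟨I ∪ Finset.univ.image k, ?_, fun x hx i => by_contra fun hi => ?_⟩
  · have h1 := Finset.card_union_le I (Finset.univ.image k)
    have h2 := Finset.card_image_le (s := Finset.univ) (f := k)
    rw [Finset.card_univ, Fintype.card_fin] at h2
    omega
  have hle1 : ∀ j, ⟪b j, x⟫ ≤ 1 := fun j => hk j x (hx _ (by simp))
  have hge : -(d * l) ≤ ∑ j, ⟪b j, x⟫ := by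
    obtain ⟨i, hiI, hxi⟩ := hI x
    by_contra! h
    exact hxi ⟨hx i (by simp [hiI]), h⟩
  obtain ⟨w, hw, hwx⟩ := exists_inner_le_one_of_notMem (hC i) (hcl i) (h0C i) hi
  rw [real_inner_smul_right, lt_inv_mul_iff₀ (by positivity), mul_one] at hwx
  refine hwx.not_ge ?_
  calc ⟪w, x⟫ = ∑ j, b.repr w j * ⟪b j, x⟫ := by
        conv_lhs => rw [← b.sum_repr w]
        simp only [sum_inner, real_inner_smul_left]
    _ ≤ ∑ j, (2 - ⟪b j, x⟫) := Finset.sum_le_sum fun j _ => by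
        calc b.repr w j * ⟪b j, x⟫ ≤ |b.repr w j| * |⟪b j, x⟫| := by
              rw [← abs_mul]; exact le_abs_self _
          _ ≤ 1 * |⟪b j, x⟫| := by gcongr; exact hrepr w ⟨i, hw⟩ j
          _ ≤ 2 - ⟪b j, x⟫ := by
              rw [one_mul, abs_le]; constructor <;> linarith [hle1 j]
    _ = d * 2 - ∑ j, ⟪b j, x⟫ := by simp [Finset.sum_sub_distrib, hd_def]
    _ ≤ d * (l + 2) := by linarith

/-- Sparse approximation of an intersection of convex sets, up to a homothety. -/
theorem exists_subfamily_subset_homothety [NormedAddCommGroup E] [InnerProductSpace ℝ E]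
    [FiniteDimensional ℝ E] (hd : 1 ≤ finrank ℝ E) {ι : Type*} [Fintype ι]
    {C : ι → Set E} (hC : ∀ i, Convex ℝ (C i)) (hcl : ∀ i, IsClosed (C i))
    (hint : (interior (⋂ i, C i)).Nonempty) (hb : Bornology.IsBounded (⋂ i, C i)) :
    ∃ σ : Finset ι, σ.card ≤ 2 * finrank ℝ E + 1 ∧ ∃ a : E, ⋂ i ∈ σ, C i ⊆
      AffineMap.homothety a (finrank ℝ E * (2 * finrank ℝ E + 3) : ℝ) '' ⋂ i, C i := by
  obtain ⟨a, ha, hsym⟩ := exists_mem_interior_forall_sub_smul_mem hd (convex_iInter hC)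
    (Metric.isCompact_of_isClosed_isBounded (isClosed_iInter hcl) hb) hint
  have hpre : ⋂ i, (Homeomorph.addRight a) ⁻¹' C i = (Homeomorph.addRight a) ⁻¹' ⋂ i, C i :=
    Set.preimage_iInter.symm
  obtain ⟨σ, hcard, hσ⟩ := exists_subfamily_smul_mem hd
    (C := fun i => (Homeomorph.addRight a) ⁻¹' C i)
    (fun i => (hC i).translate_preimage_left a)
    (fun i => (hcl i).preimage (Homeomorph.addRight a).continuous)
    (by rw [hpre, ← Homeomorph.preimage_interior]; simpa using ha)
    (by
      rw [hpre]
      obtain ⟨R, hR⟩ := hb.subset_closedBall a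
      refine (Metric.isBounded_closedBall (x := (0 : E)) (r := R)).subset fun x hx => ?_
      simpa [dist_eq_norm] using hR hx)
    (l := 2 * finrank ℝ E + 1) (by positivity)
    (fun x hx => by
      rw [hpre] at hx ⊢
      have h := hsym _ hx
      change _ + a ∈ ⋂ i, C i
      convert h using 1
      simp [sub_eq_add_neg, add_comm])
  refine ⟨σ, hcard, a, fun x hx => ?_⟩
  have hd1 : (1 : ℝ) ≤ finrank ℝ E := by exact_mod_cast hd
  have hmem := hσ (x - a) (fun i hi => by simpa using Set.mem_iInter₂.1 hx i hi)
  refine ⟨_, Set.mem_iInter.2 hmem, ?_⟩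
  simp only [Homeomorph.coe_addRight, AffineMap.homothety_apply, vsub_eq_sub, vadd_eq_add,
    add_sub_cancel_right, smul_smul]
  rw [show (2 * (finrank ℝ E : ℝ) + 1 + 2) = 2 * finrank ℝ E + 3 by ring,
    mul_inv_cancel₀ (by positivity), one_smul, sub_add_cancel]

end Geometry

section LogConcave

variable {d : ℕ}

theorem Convex.measure_eq_zero_of_interior_eq_empty {E : Type*} [NormedAddCommGroup E]
    [NormedSpace ℝ E] [FiniteDimensional ℝ E] [MeasurableSpace E] [BorelSpace E] {μ : Measure E}
    [μ.IsAddHaarMeasure] {s : Set E} (hs : Convex ℝ s) (h : interior s = ∅) : μ s = 0 := by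
  refine measure_mono_null (fun x hx => ?_) (hs.addHaar_frontier μ)
  rw [frontier, h, Set.sdiff_empty]
  exact subset_closure hx

/-- A convex set with nonempty interior and finite volume is bounded. -/
theorem Convex.isBounded_of_measure_ne_top {E : Type*} [NormedAddCommGroup E]
    [NormedSpace ℝ E] [FiniteDimensional ℝ E] [MeasurableSpace E] [BorelSpace E] {μ : Measure E}
    [μ.IsAddHaarMeasure] {s : Set E} (hs : Convex ℝ s) (hint : (interior s).Nonempty)
    (hμ : μ s ≠ ⊤) : Bornology.IsBounded s := by
  obtain ⟨p, hp⟩ := hint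
  obtain ⟨r, hr, hball⟩ := Metric.mem_nhds_iff.1 (mem_interior_iff_mem_nhds.1 hp)
  by_contra hunb
  have hlim : Filter.Tendsto (fun n : ℕ => μ (s \ Metric.closedBall p n)) Filter.atTop
      (nhds (μ (⋂ n : ℕ, s \ Metric.closedBall p n))) := by
    refine tendsto_measure_iInter_atTop
      (fun n => (hs.nullMeasurableSet μ).diff Metric.isClosed_closedBall.nullMeasurableSet)
      (fun m n hmn => Set.sdiff_subset_sdiff_right
        (Metric.closedBall_subset_closedBall (by exact_mod_cast hmn)))
      ⟨0, ((measure_mono Set.sdiff_subset).trans_lt hμ.lt_top).ne⟩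
  have hempty : ⋂ n : ℕ, s \ Metric.closedBall p n = ∅ := by
    refine Set.eq_empty_of_forall_notMem fun x hx => ?_
    obtain ⟨n, hn⟩ := exists_nat_ge (dist x p)
    exact (Set.mem_iInter.1 hx n).2 hn
  rw [hempty, measure_empty] at hlim
  obtain ⟨n, hn⟩ := (hlim.eventually_lt_const
    (Metric.measure_ball_pos μ p (half_pos hr))).exists
  have hfar : ∃ x ∈ s, 2 * (n + r) < dist x p := by
    by_contra! h
    exact hunb ((Metric.isBounded_closedBall (x := p) (r := 2 * (n + r))).subset h)
  obtain ⟨x, hx, hxp⟩ := hfar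
  have hsub : Metric.ball (midpoint ℝ x p) (r / 2) ⊆ s \ Metric.closedBall p n := by
    intro y hy
    have hmid : dist (midpoint ℝ x p) p = dist x p / 2 := by
      rw [dist_midpoint_right]; simp; ring
    rw [Metric.mem_ball] at hy
    refine ⟨?_, fun hyp => ?_⟩
    · have hz : (2 : ℝ) • y - x ∈ s := by
        apply hball
        rw [Metric.mem_ball, dist_eq_norm]
        have : (2 : ℝ) • y - x - p = (2 : ℝ) • (y - midpoint ℝ x p) := by
          rw [midpoint_eq_smul_add, smul_sub, smul_smul]; norm_num; abel
        rw [this, norm_smul, ← dist_eq_norm, Real.norm_ofNat]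
        linarith
      have h := hs hx hz (a := 1 / 2) (b := 1 / 2) (by norm_num) (by norm_num) (by norm_num)
      convert h using 1
      rw [smul_sub, smul_smul]; norm_num
    · rw [Metric.mem_closedBall] at hyp
      have := dist_triangle (midpoint ℝ x p) y p
      rw [dist_comm _ y] at this
      linarith
  have := (measure_mono hsub).trans_lt hn
  rw [Measure.addHaar_ball_center, Measure.addHaar_ball_center μ p] at this
  exact this.false

theorem IsLogConcave.convex_ge {f : Ed d → ℝ} (hf : IsLogConcave f) (c : ℝ) :
    Convex ℝ {x | c ≤ f x} := by
  intro x hx y hy a b ha hb hab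
  obtain rfl : b = 1 - a := by linarith
  rcases lt_or_ge c 0 with hc | hc
  · exact hc.le.trans (hf.1 _)
  calc c = c ^ a * c ^ (1 - a) := by rw [← Real.rpow_add' hc (by simp)]; simp
    _ ≤ f x ^ a * f y ^ (1 - a) :=
      mul_le_mul (Real.rpow_le_rpow hc hx ha) (Real.rpow_le_rpow hc hy hb)
        (Real.rpow_nonneg hc _) (Real.rpow_nonneg (hf.1 _) _)
    _ ≤ _ := hf.2 x y a ha (by linarith)

theorem IsLogConcave.convex_gt {f : Ed d → ℝ} (hf : IsLogConcave f) (c : ℝ) :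
    Convex ℝ {x | c < f x} := by
  intro x hx y hy a b ha hb hab
  have h : min (f x) (f y) ≤ f (a • x + b • y) :=
    hf.convex_ge (min (f x) (f y)) (Set.mem_ofPred.2 (min_le_left _ _))
      (Set.mem_ofPred.2 (min_le_right _ _)) ha hb hab
  exact (lt_min hx hy).trans_le h

theorem IsLogConcave.inf' {ι : Type*} {f : ι → Ed d → ℝ} (hf : ∀ i, IsLogConcave (f i))
    {σ : Finset ι} (hσ : σ.Nonempty) : IsLogConcave fun x => σ.inf' hσ fun i => f i x := by
  refine ⟨fun x => Finset.le_inf' _ _ fun i _ => (hf i).1 x, fun x y t ht0 ht1 => ?_⟩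
  refine Finset.le_inf' _ _ fun i hi => ?_
  have hnn : ∀ z, 0 ≤ σ.inf' hσ fun i => f i z := fun z =>
    Finset.le_inf' _ _ fun i _ => (hf i).1 z
  refine le_trans ?_ ((hf i).2 x y t ht0 ht1)
  have h1 : 0 ≤ 1 - t := by linarith
  exact mul_le_mul (Real.rpow_le_rpow (hnn x) (Finset.inf'_le _ hi) ht0)
    (Real.rpow_le_rpow (hnn y) (Finset.inf'_le _ hi) h1) (Real.rpow_nonneg (hnn y) _)
    (Real.rpow_nonneg ((hf i).1 x) _)

theorem UpperSemicontinuous.measurable_finset_inf' {α ι : Type*} [TopologicalSpace α]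
    [MeasurableSpace α] [OpensMeasurableSpace α] {f : ι → α → ℝ}
    (hf : ∀ i, UpperSemicontinuous (f i)) {σ : Finset ι} (hσ : σ.Nonempty) :
    Measurable fun x => σ.inf' hσ fun i => f i x := by
  refine measurable_of_Ici fun c => ?_
  have : (fun x => σ.inf' hσ fun i => f i x) ⁻¹' Set.Ici c = ⋂ i ∈ σ, f i ⁻¹' Set.Ici c := by
    ext x; simp
  rw [this]
  exact (isClosed_biInter fun i _ => (hf i).isClosed_preimage c).measurableSet

theorem IsLogConcave.exists_ball_forall_le {f : Ed d → ℝ} (hf : IsLogConcave f)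
    (hpos : 0 < ∫⁻ x, ENNReal.ofReal (f x)) :
    ∃ (p : Ed d) (r ε : ℝ), 0 < r ∧ 0 < ε ∧ ∀ x ∈ Metric.ball p r, ε ≤ f x := by
  by_contra! h
  have hnull : ∀ k : ℕ, volume {x | 1 / ((k : ℝ) + 1) ≤ f x} = 0 := by
    intro k
    refine (hf.convex_ge _).measure_eq_zero_of_interior_eq_empty
      (Set.eq_empty_of_forall_notMem fun p hp => ?_)
    obtain ⟨r, hr, hball⟩ := Metric.mem_nhds_iff.1 (mem_interior_iff_mem_nhds.1 hp)
    obtain ⟨x, hx, hlt⟩ := h p r (1 / ((k : ℝ) + 1)) hr (by positivity)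
    exact hlt.not_ge (hball hx)
  have hae : (fun x => ENNReal.ofReal (f x)) =ᵐ[volume] 0 := by
    refine measure_mono_null (fun x hx => ?_) (measure_iUnion_null hnull)
    have hx' : 0 < f x := by
      by_contra! hle
      exact hx (ENNReal.ofReal_eq_zero.2 hle)
    obtain ⟨k, hk⟩ := exists_nat_one_div_lt hx'
    exact Set.mem_iUnion.2 ⟨k, hk.le⟩
  rw [lintegral_congr_ae hae] at hpos
  simp at hpos

/-- An integrable log-concave function is bounded. -/
theorem IsLogConcave.bddAbove_range {f : Ed d → ℝ} (hf : IsLogConcave f) (hm : Measurable f)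
    (hpos : 0 < ∫⁻ x, ENNReal.ofReal (f x)) (hfin : ∫⁻ x, ENNReal.ofReal (f x) ≠ ⊤) :
    BddAbove (Set.range f) := by
  obtain ⟨p, r, ε, hr, hε, hball⟩ := hf.exists_ball_forall_le hpos
  set I := ∫⁻ x, ENNReal.ofReal (f x)
  set V := volume (Metric.ball (0 : Ed d) (r / 2))
  have hV : V ≠ 0 := (Metric.measure_ball_pos _ _ (half_pos hr)).ne'
  have hVtop : V ≠ ⊤ := measure_ball_lt_top.ne
  refine ⟨(I / V).toReal ^ 2 / ε, ?_⟩
  rintro _ ⟨x, rfl⟩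
  have hx0 := hf.1 x
  have hsub : Metric.ball (midpoint ℝ x p) (r / 2) ⊆
      {y | ENNReal.ofReal (√(f x * ε)) ≤ ENNReal.ofReal (f y)} := by
    intro y hy
    refine ENNReal.ofReal_le_ofReal ?_
    have hz : ε ≤ f ((2 : ℝ) • y - x) := by
      apply hball
      rw [Metric.mem_ball] at hy ⊢
      rw [dist_eq_norm]
      have : (2 : ℝ) • y - x - p = (2 : ℝ) • (y - midpoint ℝ x p) := by
        rw [midpoint_eq_smul_add, smul_sub, smul_smul]; norm_num; abel
      rw [this, norm_smul, ← dist_eq_norm, Real.norm_ofNat]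
      linarith
    have h := hf.2 x ((2 : ℝ) • y - x) (1 / 2) (by norm_num) (by norm_num)
    have hy' : (1 / 2 : ℝ) • x + (1 - 1 / 2 : ℝ) • ((2 : ℝ) • y - x) = y := by
      rw [smul_sub, smul_smul]; norm_num
    rw [hy'] at h
    refine le_trans ?_ h
    rw [Real.sqrt_mul hx0, Real.sqrt_eq_rpow, Real.sqrt_eq_rpow,
      show (1 - 1 / 2 : ℝ) = 1 / 2 by norm_num]
    gcongr
  have hle : ENNReal.ofReal (√(f x * ε)) * V ≤ I := by
    refine le_trans ?_ (mul_meas_ge_le_lintegral hm.ennreal_ofReal (ENNReal.ofReal (√(f x * ε))))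
    have hVeq : V = volume (Metric.ball (midpoint ℝ x p) (r / 2)) :=
      (Measure.addHaar_ball_center _ _ _).symm
    rw [hVeq]
    gcongr
  have h2 : √(f x * ε) ≤ (I / V).toReal := by
    rw [← ENNReal.ofReal_le_iff_le_toReal (ENNReal.div_ne_top hfin hV)]
    exact (ENNReal.le_div_iff_mul_le (Or.inl hV) (Or.inl hVtop)).2 hle
  rw [le_div_iff₀ hε]
  exact (Real.sqrt_le_left ENNReal.toReal_nonneg).1 h2

/-- The integral of a log-concave function is controlled by the volume of a high level set. -/
theorem IsLogConcave.lintegral_le_volume_level {g : Ed d → ℝ} (hg : IsLogConcave g)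
    (hm : Measurable g) (hd : 1 ≤ d) {M : ℝ} (hM : 0 < M) (hgM : ∀ x, g x ≤ M) {x₀ : Ed d}
    (hx₀ : M * (1 / 4) ^ d ≤ g x₀) :
    ∫⁻ x, ENNReal.ofReal (g x) ≤
      ENNReal.ofReal (2 * M) * volume {x | M * ((1 / 4) ^ d) ^ 2 ≤ g x} := by
  set q : ℝ := (1 / 4) ^ d with hq
  have hq0 : 0 < q := by positivity
  have hq1 : q < 1 := pow_lt_one₀ (by norm_num) (by norm_num) (by omega)
  set G : Set (Ed d) := {x | M * q ^ 2 ≤ g x}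
  let A : ℕ → Set (Ed d) := fun k => {x | M * q ^ (k + 1) ≤ g x}
  have hAm : ∀ k, MeasurableSet (A k) := fun k => measurableSet_le measurable_const hm
  have hsub : ∀ k, A k ⊆ AffineMap.homothety x₀ ((k : ℝ) + 1) '' G := by
    intro k x hx
    have hk : (0 : ℝ) < (k : ℝ) + 1 := by positivity
    set s : ℝ := ((k : ℝ) + 1)⁻¹ with hs
    have hs0 : 0 < s := by positivity
    have hs1 : s ≤ 1 := inv_le_one_of_one_le₀ (by linarith [k.cast_nonneg (α := ℝ)])
    refine ⟨s • x + (1 - s) • x₀, ?_, ?_⟩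
    · refine le_trans ?_ (hg.2 x x₀ s hs0.le hs1)
      have h1 : M ^ s * q ≤ g x ^ s := by
        refine le_trans (le_of_eq ?_) (Real.rpow_le_rpow (by positivity) hx hs0.le)
        rw [Real.mul_rpow hM.le (by positivity), ← Real.rpow_natCast q, ← Real.rpow_mul hq0.le]
        congr 1
        rw [show ((k + 1 : ℕ) : ℝ) * s = 1 by push_cast; rw [hs]; field_simp, Real.rpow_one]
      have h2 : M ^ (1 - s) * q ≤ g x₀ ^ (1 - s) := by
        refine le_trans ?_ (Real.rpow_le_rpow (by positivity) hx₀ (by linarith))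
        rw [Real.mul_rpow hM.le hq0.le]
        gcongr
        exact Real.self_le_rpow_of_le_one hq0.le hq1.le (by linarith)
      calc M * q ^ 2 = M ^ s * M ^ (1 - s) * (q * q) := by
            rw [← Real.rpow_add hM]; simp [sq]
        _ = (M ^ s * q) * (M ^ (1 - s) * q) := by ring
        _ ≤ _ := mul_le_mul h1 h2 (by positivity) (Real.rpow_nonneg (hg.1 _) _)
    · rw [AffineMap.homothety_apply, vsub_eq_sub, vadd_eq_add,
        show s • x + (1 - s) • x₀ - x₀ = s • (x - x₀) by rw [sub_smul, one_smul, smul_sub]; abel,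
        smul_smul, hs, mul_inv_cancel₀ hk.ne', one_smul, sub_add_cancel]
  have hvol : ∀ k, volume (A k) ≤ ENNReal.ofReal (((k : ℝ) + 1) ^ d) * volume G := by
    intro k
    refine (measure_mono (hsub k)).trans (le_of_eq ?_)
    rw [Measure.addHaar_image_homothety, finrank_euclideanSpace_fin, abs_of_nonneg (by positivity)]
  have hpt : ∀ x, ENNReal.ofReal (g x) ≤
      ∑' k, (A k).indicator (fun _ => ENNReal.ofReal (M * q ^ k)) x := by
    intro x
    rcases (hg.1 x).eq_or_lt with h0 | h0
    · simp [← h0]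
    obtain ⟨k, hk1, hk2⟩ := exists_nat_pow_near_of_lt_one (div_pos h0 hM)
      ((div_le_one hM).2 (hgM x)) hq0 hq1
    rw [lt_div_iff₀ hM, mul_comm] at hk1
    rw [div_le_iff₀ hM, mul_comm] at hk2
    refine le_trans ?_ (ENNReal.le_tsum k)
    rw [Set.indicator_of_mem (show x ∈ A k from hk1.le)]
    exact ENNReal.ofReal_le_ofReal hk2
  have hterm : ∀ k : ℕ, M * q ^ k * ((k : ℝ) + 1) ^ d ≤ M * (1 / 2) ^ k := by
    intro k
    have hk2 : ((k : ℝ) + 1) ≤ 2 ^ k := by exact_mod_cast Nat.lt_two_pow_self (n := k)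
    calc M * q ^ k * ((k : ℝ) + 1) ^ d ≤ M * q ^ k * (2 ^ k) ^ d := by gcongr
      _ = M * ((1 / 2) ^ k) ^ d := by
        rw [hq, mul_assoc, ← pow_mul, mul_comm d k, pow_mul, ← mul_pow, ← mul_pow]
        norm_num
      _ ≤ M * (1 / 2) ^ k := by
        gcongr
        exact pow_le_of_le_one (by positivity) (pow_le_one₀ (by norm_num) (by norm_num)) (by omega)
  calc ∫⁻ x, ENNReal.ofReal (g x)
      ≤ ∫⁻ x, ∑' k, (A k).indicator (fun _ => ENNReal.ofReal (M * q ^ k)) x := lintegral_mono hpt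
    _ = ∑' k, ENNReal.ofReal (M * q ^ k) * volume (A k) := by
        rw [lintegral_tsum fun k => (measurable_const.indicator (hAm k)).aemeasurable]
        simp_rw [lintegral_indicator_const (hAm _)]
    _ ≤ ∑' k : ℕ, ENNReal.ofReal (M * (1 / 2) ^ k) * volume G := by
        refine ENNReal.tsum_le_tsum fun k => ?_
        calc ENNReal.ofReal (M * q ^ k) * volume (A k)
            ≤ ENNReal.ofReal (M * q ^ k) * (ENNReal.ofReal (((k : ℝ) + 1) ^ d) * volume G) := by
              gcongr; exact hvol k
          _ = ENNReal.ofReal (M * q ^ k * ((k : ℝ) + 1) ^ d) * volume G := by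
              rw [← mul_assoc, ← ENNReal.ofReal_mul (by positivity)]
          _ ≤ _ := mul_le_mul_left (ENNReal.ofReal_le_ofReal (hterm k)) _
    _ = ENNReal.ofReal (2 * M) * volume G := by
        rw [ENNReal.tsum_mul_right, ← ENNReal.ofReal_tsum_of_nonneg (fun k => by positivity)
          (summable_geometric_two.mul_left M), tsum_mul_left, tsum_geometric_two, mul_comm M]

theorem IsLogConcave.interior_level_nonempty {f : Ed d → ℝ} (hf : IsLogConcave f)
    (hpos : 0 < ∫⁻ x, ENNReal.ofReal (f x)) {c : ℝ} {x₀ : Ed d} (hc : c < f x₀)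
    (hx₀ : 0 < f x₀) : (interior {x | c ≤ f x}).Nonempty := by
  obtain ⟨p, r, ε, hr, hε, hball⟩ := hf.exists_ball_forall_le hpos
  have hlim : Filter.Tendsto (fun t : ℝ => ε ^ t * f x₀ ^ (1 - t)) (nhdsWithin 0 (Set.Ioi 0))
      (nhds (f x₀)) := by
    have hcont : Continuous fun t : ℝ => ε ^ t * f x₀ ^ (1 - t) :=
      (Real.continuous_const_rpow hε.ne').mul
        ((Real.continuous_const_rpow hx₀.ne').comp (continuous_const.sub continuous_id))
    simpa using (hcont.tendsto 0).mono_left nhdsWithin_le_nhds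
  obtain ⟨t, htc, ht0, ht1⟩ := ((hlim.eventually_const_lt hc).and
    (Ioo_mem_nhdsGT (zero_lt_one (α := ℝ)))).exists
  refine ⟨x₀ + t • (p - x₀), mem_interior_iff_mem_nhds.2 (Metric.mem_nhds_iff.2
    ⟨t * r, by positivity, fun y hy => ?_⟩)⟩
  have hz : ε ≤ f (x₀ + t⁻¹ • (y - x₀)) := by
    apply hball
    rw [Metric.mem_ball, dist_eq_norm] at hy ⊢
    have : x₀ + t⁻¹ • (y - x₀) - p = t⁻¹ • (y - (x₀ + t • (p - x₀))) := by
      rw [← sub_sub, smul_sub _ (y - x₀), smul_smul, inv_mul_cancel₀ ht0.ne', one_smul]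
      abel
    rw [this, norm_smul, Real.norm_of_nonneg (by positivity), inv_mul_lt_iff₀ ht0]
    exact hy
  have h := hf.2 (x₀ + t⁻¹ • (y - x₀)) x₀ t ht0.le ht1.le
  have hy' : t • (x₀ + t⁻¹ • (y - x₀)) + (1 - t) • x₀ = y := by
    rw [smul_add, smul_smul, mul_inv_cancel₀ ht0.ne', sub_smul]
    simp only [one_smul]
    abel
  rw [hy'] at h
  refine htc.le.trans (le_trans ?_ h)
  gcongr

/-- A family of log-concave functions whose minimum has zero integral contains at most `d + 1`
members with the same property. -/
theorem exists_subfamily_lintegral_eq_zero {ι : Type*} [Fintype ι] [Nonempty ι]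
    {f : ι → Ed d → ℝ} (hf : ∀ i, IsLogConcave (f i)) (husc : ∀ i, UpperSemicontinuous (f i))
    (h0 : ∫⁻ x, ENNReal.ofReal (Finset.univ.inf' Finset.univ_nonempty fun i => f i x) = 0) :
    ∃ (σ : Finset ι) (hσ : σ.Nonempty), σ.card ≤ d + 1 ∧
      ∫⁻ x, ENNReal.ofReal (σ.inf' hσ fun i => f i x) = 0 := by
  rw [lintegral_eq_zero_iff
    (UpperSemicontinuous.measurable_finset_inf' husc _).ennreal_ofReal] at h0
  obtain ⟨σ, hσ, hcard, hempty⟩ := exists_helly_subfamily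
    (S := fun i => interior {x | 0 < f i x}) (fun i => ((hf i).convex_gt 0).interior) (fun x => by
      by_contra! hx
      have hx' := Set.mem_iInter.2 hx
      rw [← interior_iInter_of_finite] at hx'
      refine (Measure.measure_pos_of_mem_nhds volume (mem_interior_iff_mem_nhds.1 hx')).ne' ?_
      refine measure_mono_null (fun y hy => ?_) h0
      intro hy0
      have hle := ENNReal.ofReal_eq_zero.1 hy0
      rw [Finset.inf'_le_iff] at hle
      obtain ⟨i, -, hi⟩ := hle
      exact (Set.mem_iInter.1 hy i).not_ge hi)
  rw [finrank_euclideanSpace_fin] at hcard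
  refine ⟨σ, hσ, hcard, ?_⟩
  have hnull : volume {x | 0 < σ.inf' hσ fun i => f i x} = 0 := by
    refine ((IsLogConcave.inf' hf hσ).convex_gt 0).measure_eq_zero_of_interior_eq_empty
      (Set.eq_empty_of_forall_notMem fun x hx => ?_)
    obtain ⟨i, hi, hxi⟩ := hempty x
    refine hxi (interior_mono (fun y hy => ?_) hx)
    exact lt_of_lt_of_le (Set.mem_ofPred.1 hy) (Finset.inf'_le _ hi)
  rw [lintegral_eq_zero_iff (UpperSemicontinuous.measurable_finset_inf' husc _).ennreal_ofReal]
  refine measure_mono_null (fun x hx => ?_) hnull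
  by_contra hle
  exact hx (ENNReal.ofReal_eq_zero.2 (not_lt.1 hle))

theorem two_mul_pow_div_le_rpow (hd : 1 ≤ d) :
    2 * ((d : ℝ) * (2 * d + 3)) ^ d / ((1 / 4) ^ d) ^ 2 ≤
      (100 * (d : ℝ)) ^ ((5 * (d : ℝ)) / 2) := by
  have hd1 : (1 : ℝ) ≤ d := by exact_mod_cast hd
  calc 2 * ((d : ℝ) * (2 * d + 3)) ^ d / ((1 / 4) ^ d) ^ 2
      = 2 * (16 * ((d : ℝ) * (2 * d + 3))) ^ d := by
        rw [← pow_mul, mul_comm d 2, pow_mul, mul_pow 16, div_eq_mul_inv, ← inv_pow]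
        norm_num
        ring
    _ ≤ 2 ^ d * (16 * ((d : ℝ) * (2 * d + 3))) ^ d := by
        gcongr
        exact le_self_pow₀ (by norm_num) (by omega)
    _ ≤ ((100 * (d : ℝ)) ^ 2) ^ d := by
        rw [← mul_pow]
        gcongr
        nlinarith
    _ = (100 * (d : ℝ)) ^ (2 * (d : ℝ)) := by
        rw [← pow_mul, ← Real.rpow_natCast]; push_cast; rfl
    _ ≤ _ := Real.rpow_le_rpow_of_exponent_le (by linarith) (by linarith)

/-- Quantitative Helly for log-concave functions whose minimum has positive finite integral. -/
theorem exists_subfamily_lintegral_le {ι : Type*} [Fintype ι] [Nonempty ι] (hd : 1 ≤ d)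
    {f : ι → Ed d → ℝ} (hf : ∀ i, IsLogConcave (f i)) (husc : ∀ i, UpperSemicontinuous (f i))
    (hpos : 0 < ∫⁻ x, ENNReal.ofReal (Finset.univ.inf' Finset.univ_nonempty fun i => f i x))
    (hfin : ∫⁻ x, ENNReal.ofReal (Finset.univ.inf' Finset.univ_nonempty fun i => f i x) ≠ ⊤) :
    ∃ (σ : Finset ι) (hσ : σ.Nonempty), σ.card ≤ 3 * d + 2 ∧
      ∫⁻ x, ENNReal.ofReal (σ.inf' hσ fun i => f i x) ≤
        ENNReal.ofReal (2 * ((d : ℝ) * (2 * d + 3)) ^ d / ((1 / 4) ^ d) ^ 2) *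
          ∫⁻ x, ENNReal.ofReal (Finset.univ.inf' Finset.univ_nonempty fun i => f i x) := by
  classical
  set F : Ed d → ℝ := fun x => Finset.univ.inf' Finset.univ_nonempty fun i => f i x with hF
  have hFlc : IsLogConcave F := IsLogConcave.inf' hf _
  have hFm : Measurable F := UpperSemicontinuous.measurable_finset_inf' husc _
  have hbdd := hFlc.bddAbove_range hFm hpos hfin
  set M : ℝ := ⨆ x, F x
  have hFM : ∀ x, F x ≤ M := le_ciSup hbdd
  have hM : 0 < M := by
    obtain ⟨p, r, ε, hr, hε, hball⟩ := hFlc.exists_ball_forall_le hpos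
    exact hε.trans_le ((hball p (Metric.mem_ball_self hr)).trans (hFM p))
  set q : ℝ := (1 / 4) ^ d
  have hq0 : 0 < q := by positivity
  have hq1 : q < 1 := pow_lt_one₀ (by norm_num) (by norm_num) (by omega)
  obtain ⟨x₀, hx₀⟩ : ∃ x, M * q < F x := exists_lt_of_lt_ciSup (by nlinarith)
  set c : ℝ := M * q ^ 2
  have hc : 0 < c := by positivity
  have hinter : ⋂ i, {x | c ≤ f i x} = {x | c ≤ F x} := by
    ext x; simp [hF]
  have hlevel : ENNReal.ofReal c * volume {x | c ≤ F x} ≤ ∫⁻ x, ENNReal.ofReal (F x) := by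
    refine le_trans ?_ (mul_meas_ge_le_lintegral hFm.ennreal_ofReal (ENNReal.ofReal c))
    gcongr with x
    exact ENNReal.ofReal_le_ofReal
  have hvol : volume {x | c ≤ F x} ≠ ⊤ := fun h => hfin <| by
    rw [h, ENNReal.mul_top (by simpa using hc)] at hlevel
    exact top_le_iff.1 hlevel
  have hint : (interior {x | c ≤ F x}).Nonempty :=
    hFlc.interior_level_nonempty hpos (x₀ := x₀) (lt_trans (by simp only [c]; nlinarith) hx₀)
      (lt_trans (by positivity) hx₀)
  obtain ⟨I, hIne, hIcard, hI⟩ := exists_helly_subfamily (S := fun i => {x | M < f i x})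
    (fun i => (hf i).convex_gt M) (fun x => by
      by_contra! h
      have : M < F x := (Finset.lt_inf'_iff _).2 fun i _ => h i
      exact this.not_ge (hFM x))
  obtain ⟨J, hJcard, a, hJ⟩ := exists_subfamily_subset_homothety
    (by rwa [finrank_euclideanSpace_fin]) (C := fun i => {x | c ≤ f i x})
    (fun i => (hf i).convex_ge c) (fun i => (husc i).isClosed_preimage c)
    (by rwa [hinter])
    (by rw [hinter]; exact (hFlc.convex_ge c).isBounded_of_measure_ne_top hint hvol)
  rw [hinter] at hJ
  rw [finrank_euclideanSpace_fin] at hIcard hJcard hJ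
  have hσ : (I ∪ J).Nonempty := hIne.mono Finset.subset_union_left
  refine ⟨I ∪ J, hσ, (Finset.card_union_le I J).trans (by omega), ?_⟩
  set g : Ed d → ℝ := fun x => (I ∪ J).inf' hσ fun i => f i x
  have hgM : ∀ x, g x ≤ M := fun x => by
    obtain ⟨i, hi, hxi⟩ := hI x
    exact (Finset.inf'_le _ (Finset.mem_union_left J hi)).trans (not_lt.1 hxi)
  have hFg : F x₀ ≤ g x₀ := Finset.inf'_mono _ (Finset.subset_univ _) hσ
  have hsub : {x | c ≤ g x} ⊆
      AffineMap.homothety a ((d : ℝ) * (2 * d + 3)) '' {x | c ≤ F x} := fun x hx =>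
    hJ (Set.mem_iInter₂.2 fun i hi => Set.mem_ofPred.2 <|
      (Set.mem_ofPred.1 hx).trans (Finset.inf'_le _ (Finset.mem_union_right I hi)))
  calc ∫⁻ x, ENNReal.ofReal (g x)
      ≤ ENNReal.ofReal (2 * M) * volume {x | c ≤ g x} :=
        (IsLogConcave.inf' hf hσ).lintegral_le_volume_level
          (UpperSemicontinuous.measurable_finset_inf' husc _) hd hM hgM (hx₀.le.trans hFg)
    _ ≤ ENNReal.ofReal (2 * M) *
          (ENNReal.ofReal (((d : ℝ) * (2 * d + 3)) ^ d) * volume {x | c ≤ F x}) := by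
        gcongr
        refine (measure_mono hsub).trans (le_of_eq ?_)
        rw [Measure.addHaar_image_homothety, finrank_euclideanSpace_fin,
          abs_of_nonneg (by positivity)]
    _ = ENNReal.ofReal (2 * ((d : ℝ) * (2 * d + 3)) ^ d / q ^ 2) *
          (ENNReal.ofReal c * volume {x | c ≤ F x}) := by
        rw [← mul_assoc, ← mul_assoc, ← ENNReal.ofReal_mul (by positivity),
          ← ENNReal.ofReal_mul (by positivity)]
        congr 2
        simp only [c]
        field_simp
    _ ≤ _ := by gcongr

end LogConcave

/-- **Quantitative Helly for log-concave functions.** -/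
theorem helly_logconcave (d n : ℕ) (hd : 1 ≤ d) (hn : 0 < n)
    (f : Fin n → Ed d → ℝ)
    (hlc : ∀ i, IsLogConcave (f i)) (husc : ∀ i, UpperSemicontinuous (f i)) :
    ∃ σ : Finset (Fin n), ∃ hσ : σ.Nonempty, σ.card ≤ 3 * d + 2 ∧
      (∫⁻ x, ENNReal.ofReal (σ.inf' hσ fun i => f i x)) ≤
        ENNReal.ofReal ((100 * (d : ℝ)) ^ ((5 * (d : ℝ)) / 2)) *
          ∫⁻ x, ENNReal.ofReal
            ((Finset.univ : Finset (Fin n)).inf' ⟨⟨0, hn⟩, Finset.mem_univ _⟩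
              fun i => f i x) := by
  have : Nonempty (Fin n) := ⟨⟨0, hn⟩⟩
  set T := ∫⁻ x, ENNReal.ofReal
    ((Finset.univ : Finset (Fin n)).inf' ⟨⟨0, hn⟩, Finset.mem_univ _⟩ fun i => f i x)
  rcases eq_or_ne T 0 with h0 | h0
  · obtain ⟨σ, hσ, hcard, hint⟩ := exists_subfamily_lintegral_eq_zero hlc husc h0
    exact ⟨σ, hσ, by omega, hint.trans_le zero_le⟩
  rcases eq_or_ne T ⊤ with htop | htop
  · refine ⟨{⟨0, hn⟩}, Finset.singleton_nonempty _, by simp, ?_⟩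
    have hd0 : (0 : ℝ) < d := by exact_mod_cast hd
    rw [htop, ENNReal.mul_top (by simpa using by positivity)]
    exact le_top
  · obtain ⟨σ, hσ, hcard, hint⟩ :=
      exists_subfamily_lintegral_le hd hlc husc (pos_iff_ne_zero.2 h0) htop
    exact ⟨σ, hσ, hcard, hint.trans
      (mul_le_mul_left (ENNReal.ofReal_le_ofReal (two_mul_pow_div_le_rpow hd)) _)⟩
end
end

section
/- For every d ≥ 1, every s > 0 and every proper log-concave function f on ℝ^d, there exists a unique triple (A, α, a), with A ∈ ℝ^{d×d} positive definite, α > 0 and a ∈ ℝ^d, such that the height function of the d-symmetric ellipsoid represented by (A⊕α, a) is pointwise ≤ f^{1/s} and α^s · det A is maximal among all such triples. Equivalently, there is a unique d-symmetric ellipsoid of maximal s-volume among all d-symmetric ellipsoids contained in lift_s(f) (the John s-ellipsoid of f). -/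
open MeasureTheory
open scoped BigOperators RealInnerProductSpace

noncomputable section

open scoped MatrixOrder in
theorem Matrix.PosDef.exists_simultaneous_diagonalization {n : Type*} [Fintype n] [DecidableEq n]
    {A B : Matrix n n ℝ} (hA : A.PosDef) (hB : B.IsHermitian) :
    ∃ (P : Matrix n n ℝ) (l : n → ℝ), IsUnit P ∧ A = P.conjTranspose * P ∧
      B = P.conjTranspose * Matrix.diagonal l * P := by
  obtain ⟨C, hC⟩ := CStarAlgebra.nonneg_iff_eq_star_mul_self.mp hA.posSemidef.nonneg
  rw [Matrix.star_eq_conjTranspose] at hC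
  have hCu : IsUnit C.det := by
    have h := hA.det_pos
    rw [hC, Matrix.det_mul] at h
    exact isUnit_iff_ne_zero.mpr (right_ne_zero_of_mul h.ne')
  have hCu' : IsUnit C.conjTranspose.det := by simpa using hCu
  have hQ : (C⁻¹.conjTranspose * B * C⁻¹).IsHermitian :=
    Matrix.isHermitian_conjTranspose_mul_mul _ hB
  set U := hQ.eigenvectorUnitary with hU
  have hsp := hQ.spectral_theorem
  rw [Unitary.conjStarAlgAut_apply, Matrix.star_eq_conjTranspose, ← hU] at hsp
  have hUU : (U : Matrix n n ℝ) * (U : Matrix n n ℝ).conjTranspose = 1 :=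
    Unitary.coe_mul_star_self U
  refine ⟨(U : Matrix n n ℝ).conjTranspose * C, hQ.eigenvalues, ?_, ?_, ?_⟩
  · refine IsUnit.mul ?_ ((Matrix.isUnit_iff_isUnit_det C).mpr hCu)
    exact IsUnit.of_mul_eq_one _ (mul_eq_one_comm.mp hUU)
  · rw [Matrix.conjTranspose_mul, Matrix.conjTranspose_conjTranspose, Matrix.mul_assoc,
      ← Matrix.mul_assoc (U : Matrix n n ℝ), hUU, Matrix.one_mul, hC]
  · have : B = C.conjTranspose * (C⁻¹.conjTranspose * B * C⁻¹) * C := by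
      rw [Matrix.conjTranspose_nonsing_inv]
      simp only [Matrix.mul_assoc]
      rw [Matrix.nonsing_inv_mul _ hCu, Matrix.mul_one, Matrix.mul_nonsing_inv_cancel_left _ _ hCu']
    conv_lhs => rw [this, hsp]
    simp only [Matrix.conjTranspose_mul, Matrix.conjTranspose_conjTranspose, Matrix.mul_assoc]
    rfl

theorem Matrix.PosDef.det_lt_det_add {n : Type*} [Fintype n] [DecidableEq n]
    {A B : Matrix n n ℝ} (hA : A.PosDef) (hB : B.PosSemidef) (hB0 : B ≠ 0) :
    A.det < (A + B).det := by
  obtain ⟨P, l, hP, rfl, rfl⟩ := hA.exists_simultaneous_diagonalization hB.1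
  have hl : ∀ i, 0 ≤ l i := by
    have := (Matrix.IsUnit.posSemidef_star_left_conjugate_iff hP).mp hB
    simpa using this
  have hne : ∃ i, 0 < l i := by
    by_contra! h
    apply hB0
    have : l = 0 := funext fun i => le_antisymm (h i) (hl i)
    simp [this]
  have hadd : P.conjTranspose * P + P.conjTranspose * Matrix.diagonal l * P =
      P.conjTranspose * Matrix.diagonal (fun i => 1 + l i) * P := by
    rw [← Matrix.diagonal_add, Matrix.diagonal_one]
    noncomm_ring
  obtain ⟨i, hi⟩ := hne
  have h1 : (1 : ℝ) < ∏ i, (1 + l i) := by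
    have := Finset.prod_lt_prod (s := Finset.univ) (f := fun _ => (1 : ℝ)) (g := fun i => 1 + l i)
      (by simp) (fun i _ => by linarith [hl i]) ⟨i, by simp, by linarith⟩
    simpa using this
  have hd := hA.det_pos
  rw [hadd]
  simp only [Matrix.det_mul, Matrix.det_diagonal] at hd ⊢
  nlinarith

theorem Matrix.PosDef.det_mul_det_lt_sq_det_midpoint {n : Type*} [Fintype n] [DecidableEq n]
    {A B : Matrix n n ℝ} (hA : A.PosDef) (hB : B.PosDef) (hAB : A ≠ B) :
    A.det * B.det < ((1 / 2 : ℝ) • (A + B)).det ^ 2 := by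
  obtain ⟨P, l, hP, rfl, rfl⟩ := hA.exists_simultaneous_diagonalization hB.1
  have hl : ∀ i, 0 < l i := by
    have := (Matrix.IsUnit.posDef_star_left_conjugate_iff hP).mp hB
    simpa using this
  have hne : ∃ i, l i ≠ 1 := by
    by_contra! h
    apply hAB
    have : l = fun _ => 1 := funext h
    simp [this]
  have hadd : (1 / 2 : ℝ) • (P.conjTranspose * P + P.conjTranspose * Matrix.diagonal l * P) =
      P.conjTranspose * Matrix.diagonal (fun i => (1 + l i) / 2) * P := by
    have : Matrix.diagonal (fun i => (1 + l i) / 2) = (1 / 2 : ℝ) • (1 + Matrix.diagonal l) := by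
      rw [← Matrix.diagonal_one, Matrix.diagonal_add, ← Matrix.diagonal_smul]
      congr 1
      ext i
      simp
      ring
    rw [this]
    simp [Matrix.mul_add, Matrix.add_mul]
  obtain ⟨i, hi⟩ := hne
  have h1 : ∏ i, l i < ∏ i, ((1 + l i) / 2) ^ 2 := by
    refine Finset.prod_lt_prod (fun i _ => hl i) (fun i _ => ?_) ⟨i, by simp, ?_⟩
    · nlinarith [sq_nonneg (l i - 1)]
    · nlinarith [sq_pos_of_ne_zero (sub_ne_zero.mpr hi)]
  rw [Finset.prod_pow] at h1
  have hd := hA.det_pos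
  rw [hadd]
  simp only [Matrix.det_mul, Matrix.det_diagonal] at hd ⊢
  have := mul_lt_mul_of_pos_left h1 (pow_pos hd 2)
  linarith

theorem Convex.interior_nonempty_of_measure_pos {E : Type*} [NormedAddCommGroup E]
    [NormedSpace ℝ E] [MeasurableSpace E] [BorelSpace E] [FiniteDimensional ℝ E] {μ : Measure E}
    [μ.IsAddHaarMeasure] {K : Set E} (hK : Convex ℝ K) (h : 0 < μ K) : (interior K).Nonempty := by
  by_contra hne
  rw [Set.not_nonempty_iff_eq_empty] at hne
  have h1 : μ K ≤ μ (frontier K) := measure_mono (by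
    rw [frontier, hne, Set.sdiff_empty]
    exact subset_closure)
  rw [hK.addHaar_frontier μ] at h1
  exact absurd h (by simpa using h1)

theorem Convex.isBounded_of_measure_lt_top {E : Type*} [NormedAddCommGroup E]
    [NormedSpace ℝ E] [MeasurableSpace E] [BorelSpace E] [FiniteDimensional ℝ E] {μ : Measure E}
    [μ.IsAddHaarMeasure] {K : Set E} (hK : Convex ℝ K) (hKc : IsClosed K) (h : 0 < μ K)
    (htop : μ K < ⊤) : Bornology.IsBounded K := by
  obtain ⟨x₀, hx₀⟩ := hK.interior_nonempty_of_measure_pos h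
  obtain ⟨r, hr, hball⟩ := Metric.isOpen_iff.mp isOpen_interior x₀ hx₀
  have hball : Metric.ball x₀ r ⊆ K := hball.trans interior_subset
  have hpos : ∀ z : E, μ (Metric.ball z (r / 2)) = μ (Metric.ball 0 (r / 2)) := fun z =>
    Measure.addHaar_ball_center μ z _
  obtain ⟨L, hLK, hL, hlt⟩ := hKc.measurableSet.exists_isCompact_sdiff_lt htop.ne
    (Metric.measure_ball_pos μ (0 : E) (half_pos hr)).ne'
  obtain ⟨R, hR⟩ := hL.isBounded.subset_closedBall 0
  refine (Metric.isBounded_closedBall (x := (0 : E)) (r := 2 * (R + r) + ‖x₀‖)).subset fun p hp => ?_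
  rw [mem_closedBall_zero_iff]
  by_contra! hp'
  refine absurd hlt (not_lt.mpr ?_)
  rw [← hpos ((1 / 2 : ℝ) • (x₀ + p))]
  refine measure_mono fun z hz => ⟨?_, fun hzL => ?_⟩
  · have hz' : (2 : ℝ) • z - p ∈ K := by
      apply hball
      rw [mem_ball_iff_norm] at hz ⊢
      have : (2 : ℝ) • z - p - x₀ = (2 : ℝ) • (z - (1 / 2 : ℝ) • (x₀ + p)) := by module
      rw [this, norm_smul, Real.norm_ofNat]
      linarith
    have := hK hz' hp (a := 1 / 2) (b := 1 / 2) (by norm_num) (by norm_num) (by norm_num)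
    convert this using 1
    module
  · have h1 := hR hzL
    rw [mem_closedBall_zero_iff] at h1
    rw [mem_ball_iff_norm] at hz
    have h2 : p = (2 : ℝ) • z - (2 : ℝ) • (z - (1 / 2 : ℝ) • (x₀ + p)) - x₀ := by module
    have h3 : ‖p‖ ≤ 2 * ‖z‖ + 2 * ‖z - (1 / 2 : ℝ) • (x₀ + p)‖ + ‖x₀‖ := by
      conv_lhs => rw [h2]
      refine (norm_sub_le _ _).trans ?_
      gcongr
      refine (norm_sub_le _ _).trans ?_
      rw [norm_smul, norm_smul, Real.norm_ofNat]
    linarith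

/-- The height constraint of the ellipsoid represented by `(A ⊕ α, a)`, raised to the power `s`. -/
def IsFeasible {d : ℕ} (s : ℝ) (f : Ed d → ℝ) (A : Matrix (Fin d) (Fin d) ℝ) (α : ℝ) (a : Ed d) :
    Prop :=
  ∀ y : Ed d, ‖y‖ ≤ 1 → α ^ s * (1 - ‖y‖ ^ 2) ^ (s / 2) ≤ f (Matrix.toEuclideanLin A y + a)

theorem ellE_subset_sLift_iff {d : ℕ} {s : ℝ} (hs : 0 < s) {f : Ed d → ℝ} (hf : ∀ x, 0 ≤ f x)
    {A : Matrix (Fin d) (Fin d) ℝ} {α : ℝ} (hα : 0 ≤ α) {a : Ed d} :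
    ellE A α a ⊆ sLift s f ↔ IsFeasible s f A α a := by
  have key : ∀ y : Ed d, ‖y‖ ≤ 1 →
      (α * √(1 - ‖y‖ ^ 2) ≤ f (Matrix.toEuclideanLin A y + a) ^ (1 / s) ↔
        α ^ s * (1 - ‖y‖ ^ 2) ^ (s / 2) ≤ f (Matrix.toEuclideanLin A y + a)) := by
    intro y hy
    have hy' : 0 ≤ 1 - ‖y‖ ^ 2 := by nlinarith [norm_nonneg y]
    rw [one_div, Real.le_rpow_inv_iff_of_pos (by positivity) (hf _) hs,
      Real.mul_rpow hα (Real.sqrt_nonneg _), Real.sqrt_eq_rpow, ← Real.rpow_mul hy']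
    ring_nf
  constructor
  · intro h y hy
    have hy' : 0 ≤ 1 - ‖y‖ ^ 2 := by nlinarith [norm_nonneg y]
    rw [← key y hy]
    have := h (show (Matrix.toEuclideanLin A y + a, α * √(1 - ‖y‖ ^ 2)) ∈ ellE A α a from
      ⟨y, √(1 - ‖y‖ ^ 2), by rw [Real.sq_sqrt hy']; linarith, rfl, rfl⟩)
    exact (le_abs_self _).trans this
  · rintro h ⟨x, ξ⟩ ⟨y, t, hyt, hx, hξ⟩
    simp only at hx hξ
    subst hx hξ
    have hy : ‖y‖ ≤ 1 := by
      nlinarith [norm_nonneg y, sq_nonneg t]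
    refine le_trans ?_ ((key y hy).mpr (h y hy))
    simp only [abs_mul, abs_of_nonneg hα]
    gcongr
    exact Real.abs_le_sqrt (by linarith)

theorem IsLogConcave.convex_superlevel {d : ℕ} {f : Ed d → ℝ} (hf : IsLogConcave f) {c : ℝ}
    (hc : 0 < c) : Convex ℝ {x | c ≤ f x} := by
  intro x hx y hy t u ht hu htu
  obtain rfl : u = 1 - t := by linarith
  refine le_trans ?_ (hf.2 x y t ht (by linarith))
  calc c = c ^ t * c ^ (1 - t) := by rw [← Real.rpow_add hc]; simp
    _ ≤ _ := mul_le_mul (Real.rpow_le_rpow hc.le hx ht) (Real.rpow_le_rpow hc.le hy hu)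
      (by positivity) (Real.rpow_nonneg (hf.1 x) t)

theorem ProperLogConcave.isClosed_superlevel {d : ℕ} {f : Ed d → ℝ} (hf : ProperLogConcave f)
    (c : ℝ) : IsClosed {x | c ≤ f x} :=
  hf.2.1.isClosed_preimage c

theorem ProperLogConcave.measurable {d : ℕ} {f : Ed d → ℝ} (hf : ProperLogConcave f) :
    Measurable f :=
  hf.2.1.measurable

theorem ProperLogConcave.exists_superlevel_measure_pos {d : ℕ} {f : Ed d → ℝ}
    (hf : ProperLogConcave f) : ∃ c > 0, 0 < volume {x | c ≤ f x} := by
  by_contra! h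
  refine hf.2.2.1.ne' ?_
  rw [lintegral_eq_zero_iff hf.measurable.ennreal_ofReal]
  have h1 : ∀ n : ℕ, ∀ᵐ x, f x < 1 / ((n : ℝ) + 1) := by
    intro n
    have := h (1 / ((n : ℝ) + 1)) (by positivity)
    rw [ae_iff]
    simpa using this
  filter_upwards [ae_all_iff.mpr h1] with x hx
  rw [Pi.zero_apply, ENNReal.ofReal_eq_zero]
  by_contra! hx0
  obtain ⟨n, hn⟩ := exists_nat_one_div_lt hx0
  exact lt_asymm hn (hx n)

theorem ProperLogConcave.superlevel_measure_lt_top {d : ℕ} {f : Ed d → ℝ}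
    (hf : ProperLogConcave f) {c : ℝ} (hc : 0 < c) : volume {x | c ≤ f x} < ⊤ := by
  have h := meas_ge_le_lintegral_div (μ := volume) hf.measurable.ennreal_ofReal.aemeasurable
    (ε := ENNReal.ofReal c) (by simpa using hc) ENNReal.ofReal_ne_top
  refine lt_of_le_of_lt (le_trans (measure_mono fun x hx => ?_) h)
    (ENNReal.div_lt_top hf.2.2.2.ne (by simpa using hc))
  exact ENNReal.ofReal_le_ofReal hx

theorem ProperLogConcave.isBounded_superlevel {d : ℕ} {f : Ed d → ℝ} (hf : ProperLogConcave f)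
    {c : ℝ} (hc : 0 < c) : Bornology.IsBounded {x | c ≤ f x} := by
  obtain ⟨c₀, hc₀, hpos⟩ := hf.exists_superlevel_measure_pos
  have hm : 0 < min c c₀ := lt_min hc hc₀
  refine Bornology.IsBounded.subset ?_ (fun x (hx : c ≤ f x) => (min_le_left c c₀).trans hx)
  refine (hf.1.convex_superlevel hm).isBounded_of_measure_lt_top (hf.isClosed_superlevel _)
    (lt_of_lt_of_le hpos (measure_mono fun x (hx : c₀ ≤ f x) => (min_le_right c c₀).trans hx))
    (hf.superlevel_measure_lt_top hm)

theorem ProperLogConcave.exists_upper_bound {d : ℕ} {f : Ed d → ℝ} (hf : ProperLogConcave f) :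
    ∃ M, 0 < M ∧ ∀ x, f x ≤ M := by
  have hK : IsCompact {x | 1 ≤ f x} :=
    Metric.isCompact_of_isClosed_isBounded (hf.isClosed_superlevel 1)
      (hf.isBounded_superlevel one_pos)
  obtain ⟨M, hM⟩ := (hf.2.1.upperSemicontinuousOn _).bddAbove_of_isCompact hK
  refine ⟨max M 1, by positivity, fun x => ?_⟩
  by_cases hx : 1 ≤ f x
  · exact (hM ⟨x, hx, rfl⟩).trans (le_max_left _ _)
  · exact (not_le.mp hx).le.trans (le_max_right _ _)

theorem ProperLogConcave.exists_mul_superlevel_measure_lt {d : ℕ} {f : Ed d → ℝ}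
    (hf : ProperLogConcave f) {ε : ENNReal} (hε : 0 < ε) :
    ∃ η₀ > 0, ∀ η, 0 < η → η < η₀ → ENNReal.ofReal η * volume {x | η ≤ f x} < ε := by
  have hlim : Filter.Tendsto
      (fun η : ℝ => ∫⁻ x, min (ENNReal.ofReal (f x)) (ENNReal.ofReal η)) (nhds 0)
      (nhds (∫⁻ _ : Ed d, 0)) := by
    refine tendsto_lintegral_filter_of_dominated_convergence (fun x => ENNReal.ofReal (f x))
      (Filter.Eventually.of_forall fun η => hf.measurable.ennreal_ofReal.min measurable_const)
      (Filter.Eventually.of_forall fun η => Filter.Eventually.of_forall fun x => min_le_left _ _)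
      hf.2.2.2.ne (Filter.Eventually.of_forall fun x => ?_)
    have : Continuous fun η : ℝ => min (ENNReal.ofReal (f x)) (ENNReal.ofReal η) :=
      continuous_const.min ENNReal.continuous_ofReal
    simpa using this.tendsto 0
  rw [lintegral_zero] at hlim
  obtain ⟨η₀, hη₀, h⟩ := Metric.eventually_nhds_iff.mp (hlim.eventually (gt_mem_nhds hε))
  refine ⟨η₀, hη₀, fun η hη hlt => lt_of_le_of_lt ?_ (h (y := η) (by simpa [abs_of_pos hη]))⟩
  refine le_trans ?_ (mul_meas_ge_le_lintegral₀
    (hf.measurable.ennreal_ofReal.min measurable_const).aemeasurable (ENNReal.ofReal η))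
  gcongr with x
  intro hx
  exact le_min (ENNReal.ofReal_le_ofReal hx) le_rfl

theorem kappa_pos (d : ℕ) {s : ℝ} (hs : 0 < s) : 0 < kappa d s := by
  have hcont : Continuous fun x : Ed d => (1 - ‖x‖ ^ 2) ^ (s / 2) :=
    Continuous.rpow_const (by fun_prop) fun _ => Or.inr (by positivity)
  have hnn : ∀ x ∈ Metric.closedBall (0 : Ed d) 1, 0 ≤ (1 - ‖x‖ ^ 2) ^ (s / 2) := fun x hx => by
    rw [mem_closedBall_zero_iff] at hx
    exact Real.rpow_nonneg (by nlinarith [norm_nonneg x]) _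
  unfold kappa
  rw [setIntegral_pos_iff_support_of_nonneg_ae
    ((ae_restrict_iff' measurableSet_closedBall).mpr (Filter.Eventually.of_forall hnn))
    (hcont.continuousOn.integrableOn_compact (isCompact_closedBall _ _))]
  refine lt_of_lt_of_le (Metric.measure_ball_pos volume (0 : Ed d) one_pos)
    (measure_mono fun x hx => ⟨?_, Metric.ball_subset_closedBall hx⟩)
  rw [mem_ball_zero_iff] at hx
  rw [Function.mem_support]
  exact (Real.rpow_pos_of_pos (by nlinarith [norm_nonneg x]) _).ne'

theorem svol_le_svol_iff {d : ℕ} {s : ℝ} (hs : 0 < s) {A B : Matrix (Fin d) (Fin d) ℝ} {α β : ℝ} :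
    svol s A α ≤ svol s B β ↔ α ^ s * A.det ≤ β ^ s * B.det := by
  rw [svol, svol, mul_assoc, mul_assoc, mul_le_mul_iff_right₀ (kappa_pos d hs)]

theorem isJohn_iff {d : ℕ} {s : ℝ} (hs : 0 < s) {f : Ed d → ℝ} (hf : ∀ x, 0 ≤ f x)
    {A : Matrix (Fin d) (Fin d) ℝ} {α : ℝ} {a : Ed d} :
    IsJohn s f A α a ↔ A.PosDef ∧ 0 < α ∧ IsFeasible s f A α a ∧
      ∀ (B : Matrix (Fin d) (Fin d) ℝ) (β : ℝ) (b : Ed d), B.PosDef → 0 < β →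
        IsFeasible s f B β b → β ^ s * B.det ≤ α ^ s * A.det := by
  refine and_congr_right fun hA => and_congr_right fun hα => and_congr
    (ellE_subset_sLift_iff hs hf hα.le) (forall₃_congr fun B β b => ?_)
  refine imp_congr_right fun hB => imp_congr_right fun hβ => imp_congr
    (ellE_subset_sLift_iff hs hf hβ.le) (svol_le_svol_iff hs)

theorem IsFeasible.midpoint {d : ℕ} {s : ℝ} {f : Ed d → ℝ} (hf : IsLogConcave f)
    {A B : Matrix (Fin d) (Fin d) ℝ} {α β : ℝ} {a b : Ed d} (hα : 0 ≤ α) (hβ : 0 ≤ β)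
    (hA : IsFeasible s f A α a) (hB : IsFeasible s f B β b) :
    IsFeasible s f ((1 / 2 : ℝ) • (A + B)) (√(α * β)) ((1 / 2 : ℝ) • (a + b)) := by
  intro y hy
  have hu : 0 ≤ (1 - ‖y‖ ^ 2) ^ (s / 2) :=
    Real.rpow_nonneg (by nlinarith [norm_nonneg y]) _
  have hαs : 0 ≤ α ^ s := Real.rpow_nonneg hα s
  have hβs : 0 ≤ β ^ s := Real.rpow_nonneg hβ s
  have h := hf.2 (Matrix.toEuclideanLin A y + a) (Matrix.toEuclideanLin B y + b) (1 / 2)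
    (by norm_num) (by norm_num)
  have hpt : (1 / 2 : ℝ) • (Matrix.toEuclideanLin A y + a) +
      (1 - 1 / 2 : ℝ) • (Matrix.toEuclideanLin B y + b) =
      Matrix.toEuclideanLin ((1 / 2 : ℝ) • (A + B)) y + (1 / 2 : ℝ) • (a + b) := by
    rw [map_smul, map_add, LinearMap.smul_apply, LinearMap.add_apply]
    module
  rw [hpt] at h
  refine le_trans ?_ h
  have h12 : (1 - 1 / 2 : ℝ) = 1 / 2 := by norm_num
  rw [h12, ← Real.sqrt_eq_rpow, ← Real.sqrt_eq_rpow, ← Real.sqrt_mul (hf.1 _)]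
  refine le_trans (le_of_eq ?_) (Real.sqrt_le_sqrt (mul_le_mul (hA y hy) (hB y hy)
    (mul_nonneg hβs hu) (hf.1 _)))
  rw [mul_mul_mul_comm, Real.sqrt_mul (mul_nonneg hαs hβs), Real.sqrt_mul_self hu,
    ← Real.mul_rpow hα hβ, Real.sqrt_eq_rpow, Real.sqrt_eq_rpow, ← Real.rpow_mul (by positivity),
    ← Real.rpow_mul (by positivity), mul_comm s]

theorem IsFeasible.stretch {d : ℕ} {s : ℝ} {f : Ed d → ℝ} (hf : IsLogConcave f)
    {A : Matrix (Fin d) (Fin d) ℝ} {α : ℝ} {a v : Ed d} {r : ℝ} (hα : 0 ≤ α) (hr : 0 ≤ r)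
    (hrv : r * ‖v‖ ≤ 1) (h₁ : IsFeasible s f A α (a + v)) (h₂ : IsFeasible s f A α (a - v)) :
    IsFeasible s f (A + r • Matrix.vecMulVec v.ofLp v.ofLp) α a := by
  intro y hy
  have hu : 0 ≤ (1 - ‖y‖ ^ 2) ^ (s / 2) :=
    Real.rpow_nonneg (by nlinarith [norm_nonneg y]) _
  have hc : 0 ≤ α ^ s * (1 - ‖y‖ ^ 2) ^ (s / 2) := mul_nonneg (Real.rpow_nonneg hα s) hu
  rcases hc.eq_or_lt with hc | hc
  · rw [← hc]
    exact hf.1 _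
  have hτ : |r * ⟪v, y⟫| ≤ 1 := by
    rw [abs_mul, abs_of_nonneg hr]
    have := abs_real_inner_le_norm v y
    nlinarith [norm_nonneg v, norm_nonneg y, mul_le_mul_of_nonneg_left this hr,
      mul_le_mul_of_nonneg_left hy (norm_nonneg v)]
  rw [abs_le] at hτ
  have h := hf.convex_superlevel hc (h₁ y hy) (h₂ y hy)
    (a := (1 + r * ⟪v, y⟫) / 2) (b := (1 - r * ⟪v, y⟫) / 2) (by linarith) (by linarith)
    (by ring)
  have hpt : Matrix.toEuclideanLin (A + r • Matrix.vecMulVec v.ofLp v.ofLp) y =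
      Matrix.toEuclideanLin A y + (r * ⟪v, y⟫) • v := by
    rw [map_add, LinearMap.add_apply, map_smul, LinearMap.smul_apply, mul_smul]
    congr 2
    ext i
    simp [Matrix.toLpLin_apply, Matrix.vecMulVec_mulVec, PiLp.inner_apply, dotProduct,
      mul_comm]
  have hcomb : Matrix.toEuclideanLin A y + (r * ⟪v, y⟫) • v + a =
      ((1 + r * ⟪v, y⟫) / 2) • (Matrix.toEuclideanLin A y + (a + v)) +
        ((1 - r * ⟪v, y⟫) / 2) • (Matrix.toEuclideanLin A y + (a - v)) := by module
  rw [hpt, hcomb]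
  exact h

theorem exists_isFeasible {d : ℕ} {s : ℝ} (hs : 0 < s) {f : Ed d → ℝ} (hf : ProperLogConcave f) :
    ∃ (A : Matrix (Fin d) (Fin d) ℝ) (α : ℝ) (a : Ed d),
      A.PosDef ∧ 0 < α ∧ IsFeasible s f A α a := by
  obtain ⟨c, hc, hpos⟩ := hf.exists_superlevel_measure_pos
  obtain ⟨x, hx⟩ := (hf.1.convex_superlevel hc).interior_nonempty_of_measure_pos hpos
  obtain ⟨r, hr, hball⟩ := Metric.nhds_basis_closedBall.mem_iff.mp (mem_interior_iff_mem_nhds.mp hx)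
  refine ⟨r • 1, c ^ s⁻¹, x, Matrix.PosDef.one.smul hr, by positivity, fun y hy => ?_⟩
  have h1 : c ≤ f (Matrix.toEuclideanLin (r • (1 : Matrix (Fin d) (Fin d) ℝ)) y + x) := by
    apply hball
    rw [mem_closedBall_iff_norm, add_sub_cancel_right, map_smul, LinearMap.smul_apply, norm_smul,
      Real.norm_of_nonneg hr.le]
    simpa [Matrix.toLpLin_apply] using mul_le_mul_of_nonneg_left hy hr.le
  refine le_trans ?_ h1
  rw [Real.rpow_inv_rpow hc.le hs.ne']
  have : (1 - ‖y‖ ^ 2) ^ (s / 2) ≤ 1 := by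
    refine Real.rpow_le_one ?_ ?_ (by positivity) <;> nlinarith [norm_nonneg y]
  exact mul_le_of_le_one_right hc.le this

theorem IsFeasible.le_of_norm_le_half {d : ℕ} {s : ℝ} (hs : 0 < s) {f : Ed d → ℝ}
    {A : Matrix (Fin d) (Fin d) ℝ} {α : ℝ} {a : Ed d} (hα : 0 ≤ α) (h : IsFeasible s f A α a)
    {y : Ed d} (hy : ‖y‖ ≤ 1 / 2) :
    α ^ s * (3 / 4 : ℝ) ^ (s / 2) ≤ f (Matrix.toEuclideanLin A y + a) := by
  refine le_trans ?_ (h y (by linarith))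
  have : (3 / 4 : ℝ) ≤ 1 - ‖y‖ ^ 2 := by nlinarith [norm_nonneg y]
  gcongr

theorem IsFeasible.det_mul_le_volume {d : ℕ} {s : ℝ} (hs : 0 < s) {f : Ed d → ℝ}
    {A : Matrix (Fin d) (Fin d) ℝ} {α : ℝ} {a : Ed d} (hα : 0 ≤ α) (hA : 0 ≤ A.det)
    (h : IsFeasible s f A α a) :
    ENNReal.ofReal A.det * volume (Metric.closedBall (0 : Ed d) (1 / 2)) ≤
      volume {x | α ^ s * (3 / 4 : ℝ) ^ (s / 2) ≤ f x} := by
  have h1 := Measure.addHaar_image_linearMap volume (Matrix.toEuclideanLin A)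
    (Metric.closedBall (0 : Ed d) (1 / 2))
  rw [LinearMap.det_toLpLin, abs_of_nonneg hA] at h1
  rw [← h1, ← measure_preimage_add_right volume a {x | _ ≤ f x}]
  refine measure_mono ?_
  rintro _ ⟨y, hy, rfl⟩
  exact h.le_of_norm_le_half hs hα (mem_closedBall_zero_iff.mp hy)

theorem isClosed_setOf_isFeasible {d : ℕ} {s : ℝ} (hs : 0 < s) {f : Ed d → ℝ}
    (hf : UpperSemicontinuous f) :
    IsClosed {p : Matrix (Fin d) (Fin d) ℝ × ℝ × Ed d | IsFeasible s f p.1 p.2.1 p.2.2} := by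
  simp only [IsFeasible, Set.ofPred_forall]
  refine isClosed_iInter fun y => isClosed_iInter fun _ => ?_
  have hcont : Continuous fun p : Matrix (Fin d) (Fin d) ℝ × ℝ × Ed d =>
      (Matrix.toEuclideanLin p.1 y + p.2.2, p.2.1 ^ s * (1 - ‖y‖ ^ 2) ^ (s / 2)) := by
    refine Continuous.prodMk ?_ ?_
    · simp only [Matrix.toLpLin_apply]
      exact ((PiLp.continuous_toLp 2 _).comp
        (continuous_fst.matrix_mulVec continuous_const)).add (by fun_prop)
    · exact ((continuous_snd.fst).rpow_const fun _ => Or.inr hs.le).mul continuous_const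
  exact hf.IsClosed_hypograph.preimage hcont

theorem Matrix.isClosed_setOf_posSemidef {n : Type*} [Fintype n] :
    IsClosed {A : Matrix n n ℝ | A.PosSemidef} := by
  simp only [Matrix.posSemidef_iff_dotProduct_mulVec, Set.ofPred_and, Set.ofPred_forall]
  refine IsClosed.inter (isClosed_eq (by fun_prop) continuous_id) (isClosed_iInter fun x => ?_)
  exact isClosed_le continuous_const
    (continuous_const.dotProduct (continuous_id.matrix_mulVec continuous_const))

theorem continuous_rpow_mul_det {d : ℕ} {s : ℝ} (hs : 0 < s) :
    Continuous fun p : Matrix (Fin d) (Fin d) ℝ × ℝ × Ed d => p.2.1 ^ s * p.1.det :=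
  ((continuous_snd.fst).rpow_const fun _ => Or.inr hs.le).mul continuous_fst.matrix_det

theorem isCompact_setOf_isFeasible {d : ℕ} {s : ℝ} (hs : 0 < s) {f : Ed d → ℝ}
    (hf : ProperLogConcave f) {m : ℝ} (hm : 0 < m) :
    IsCompact {p : Matrix (Fin d) (Fin d) ℝ × ℝ × Ed d | p.1.PosSemidef ∧ 0 ≤ p.2.1 ∧
      IsFeasible s f p.1 p.2.1 p.2.2 ∧ m ≤ p.2.1 ^ s * p.1.det} := by
  obtain ⟨M, hM, hfM⟩ := hf.exists_upper_bound
  set k : ℝ := (3 / 4 : ℝ) ^ (s / 2) with hk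
  have hk0 : 0 < k := by positivity
  set V := volume (Metric.closedBall (0 : Ed d) (1 / 2)) with hV
  have hV0 : 0 < V := Metric.measure_closedBall_pos volume _ (by norm_num)
  obtain ⟨η, hη, hsmall⟩ := hf.exists_mul_superlevel_measure_lt
    (ε := ENNReal.ofReal (m * k) * V) (ENNReal.mul_pos (by simp; positivity) hV0.ne')
  obtain ⟨R, hR⟩ := (hf.isBounded_superlevel hη).subset_closedBall 0
  have hentries : IsCompact {A : Matrix (Fin d) (Fin d) ℝ |
      ∀ i j, A i j ∈ Set.Icc (-(4 * R)) (4 * R)} := by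
    have h : IsCompact (Set.univ.pi fun _ : Fin d => Set.univ.pi fun _ : Fin d =>
        Set.Icc (-(4 * R)) (4 * R)) :=
      isCompact_univ_pi fun _ => isCompact_univ_pi fun _ => isCompact_Icc
    simp only [Set.pi, Set.mem_univ, true_imp_iff] at h
    exact h
  have hbox := hentries.prod ((isCompact_Icc (a := 0) (b := M ^ s⁻¹)).prod
    (isCompact_closedBall (0 : Ed d) R))
  refine hbox.of_isClosed_subset ?_ ?_
  · have hdet : IsClosed {p : Matrix (Fin d) (Fin d) ℝ × ℝ × Ed d | m ≤ p.2.1 ^ s * p.1.det} :=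
      isClosed_le continuous_const (continuous_rpow_mul_det hs)
    exact (Matrix.isClosed_setOf_posSemidef.preimage continuous_fst).inter
      ((isClosed_le continuous_const continuous_snd.fst).inter
        ((isClosed_setOf_isFeasible hs hf.2.1).inter hdet))
  · rintro ⟨A, α, a⟩ ⟨hA, hα, hfeas, hvol⟩
    simp only at hA hα hfeas hvol
    have hαs : 0 < α ^ s := by
      refine (Real.rpow_nonneg hα s).lt_of_ne' fun h => ?_
      rw [h] at hvol
      linarith
    have hηle : η ≤ α ^ s * k := by
      by_contra! hlt
      refine absurd (hsmall (α ^ s * k) (by positivity) hlt) (not_lt.mpr ?_)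
      refine le_trans ?_ (mul_le_mul_right (hfeas.det_mul_le_volume hs hα hA.det_nonneg) _)
      rw [← mul_assoc, ← ENNReal.ofReal_mul (by positivity)]
      have hmk := mul_le_mul_of_nonneg_right hvol hk0.le
      exact mul_le_mul' (ENNReal.ofReal_le_ofReal (by linarith)) le_rfl
    have hin : ∀ y : Ed d, ‖y‖ ≤ 1 / 2 → ‖Matrix.toEuclideanLin A y + a‖ ≤ R := fun y hy =>
      mem_closedBall_zero_iff.mp (hR (hηle.trans (hfeas.le_of_norm_le_half hs hα hy)))
    have ha : ‖a‖ ≤ R := by simpa using hin 0 (by simp)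
    refine ⟨fun i j => abs_le.mp ?_, ⟨hα, ?_⟩, mem_closedBall_zero_iff.mpr ha⟩
    · have h1 := hin ((1 / 2 : ℝ) • EuclideanSpace.single j 1) (by simp [norm_smul])
      have h2 : ‖Matrix.toEuclideanLin A ((1 / 2 : ℝ) • EuclideanSpace.single j 1)‖ ≤ 2 * R := by
        have := norm_sub_le (Matrix.toEuclideanLin A ((1 / 2 : ℝ) • EuclideanSpace.single j 1) + a) a
        rw [add_sub_cancel_right] at this
        linarith
      have h3 := (PiLp.norm_apply_le _ i).trans h2
      simp only [map_smul, PiLp.smul_apply, norm_smul, Matrix.toLpLin_apply,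
        PiLp.ofLp_single, Matrix.mulVec_single_one, Matrix.col_apply,
        Real.norm_eq_abs, one_div, abs_inv, Nat.abs_ofNat] at h3
      linarith
    · rw [Real.le_rpow_inv_iff_of_pos hα hM.le hs]
      have := hfeas 0 (by simp)
      simp only [norm_zero, ne_eq, OfNat.ofNat_ne_zero, not_false_eq_true, zero_pow, sub_zero,
        Real.one_rpow, mul_one] at this
      exact this.trans (hfM _)

theorem exists_isJohn {d : ℕ} {s : ℝ} (hs : 0 < s) {f : Ed d → ℝ} (hf : ProperLogConcave f) :
    ∃ (A : Matrix (Fin d) (Fin d) ℝ) (α : ℝ) (a : Ed d), IsJohn s f A α a := by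
  obtain ⟨A₀, α₀, a₀, hA₀, hα₀, hfeas₀⟩ := exists_isFeasible hs hf
  have hm : 0 < α₀ ^ s * A₀.det := mul_pos (Real.rpow_pos_of_pos hα₀ s) hA₀.det_pos
  obtain ⟨⟨A, α, a⟩, ⟨hA, hα, hfeas, hvol⟩, hmax⟩ :=
    (isCompact_setOf_isFeasible hs hf hm).exists_isMaxOn
      ⟨(A₀, α₀, a₀), hA₀.posSemidef, hα₀.le, hfeas₀, le_rfl⟩ (continuous_rpow_mul_det hs).continuousOn
  simp only at hA hα hfeas hvol
  have hpos : 0 < α ^ s * A.det := hm.trans_le hvol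
  have hα' : 0 < α := hα.lt_of_ne' fun h => by
    rw [h, Real.zero_rpow hs.ne', zero_mul] at hpos
    exact hpos.false
  refine ⟨A, α, a, (isJohn_iff hs hf.1.1).mpr
    ⟨hA.posDef_iff_det_ne_zero.mpr (right_ne_zero_of_mul hpos.ne'), hα', hfeas, ?_⟩⟩
  intro B β b hB hβ hBfeas
  by_cases h : α₀ ^ s * A₀.det ≤ β ^ s * B.det
  · exact hmax (show (B, β, b) ∈ _ from ⟨hB.posSemidef, hβ.le, hBfeas, h⟩)
  · exact (not_le.mp h).le.trans hvol

theorem IsJohn.unique {d : ℕ} {s : ℝ} (hs : 0 < s) {f : Ed d → ℝ} (hf : IsLogConcave f)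
    {A B : Matrix (Fin d) (Fin d) ℝ} {α β : ℝ} {a b : Ed d} (h₁ : IsJohn s f A α a)
    (h₂ : IsJohn s f B β b) : A = B ∧ α = β ∧ a = b := by
  obtain ⟨hA, hα, hAf, hAmax⟩ := (isJohn_iff hs hf.1).mp h₁
  obtain ⟨hB, hβ, hBf, hBmax⟩ := (isJohn_iff hs hf.1).mp h₂
  have hαs : 0 < α ^ s := Real.rpow_pos_of_pos hα s
  have hβs : 0 < β ^ s := Real.rpow_pos_of_pos hβ s
  have hvol : α ^ s * A.det = β ^ s * B.det :=
    le_antisymm (hBmax A α a hA hα hAf) (hAmax B β b hB hβ hBf)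
  have hAB : A = B := by
    by_contra hne
    have hlt := hA.det_mul_det_lt_sq_det_midpoint hB hne
    have hmid : ((1 / 2 : ℝ) • (A + B)).PosDef := (hA.add hB).smul (by norm_num)
    have hle := hAmax _ _ _ hmid (Real.sqrt_pos.mpr (mul_pos hα hβ))
      (hAf.midpoint hf hα.le hβ.le hBf)
    have hsq : (√(α * β) ^ s) ^ 2 = α ^ s * β ^ s := by
      rw [← Real.mul_rpow hα.le hβ.le, ← Real.rpow_natCast, ← Real.rpow_mul (by positivity),
        mul_comm s, Real.rpow_mul (by positivity), Real.rpow_natCast,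
        Real.sq_sqrt (by positivity)]
    have h2 := pow_le_pow_left₀
      (mul_nonneg (Real.rpow_nonneg (Real.sqrt_nonneg _) s) hmid.det_pos.le) hle 2
    rw [mul_pow, hsq] at h2
    have h3 := mul_lt_mul_of_pos_left hlt (mul_pos hαs hβs)
    have h4 : (α ^ s * A.det) ^ 2 = α ^ s * β ^ s * (A.det * B.det) := by
      rw [sq]
      nth_rewrite 2 [hvol]
      ring
    linarith
  subst hAB
  have hαβ : α = β :=
    (Real.rpow_left_inj hα.le hβ.le hs.ne').mp (mul_right_cancel₀ hA.det_pos.ne' hvol)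
  subst hαβ
  refine ⟨rfl, rfl, ?_⟩
  by_contra hne
  set v : Ed d := (1 / 2 : ℝ) • (a - b) with hv
  have hv0 : v ≠ 0 := smul_ne_zero (by norm_num) (sub_ne_zero.mpr hne)
  have hr : 0 < ‖v‖⁻¹ := inv_pos.mpr (norm_pos_iff.mpr hv0)
  have hfeas : IsFeasible s f (A + ‖v‖⁻¹ • Matrix.vecMulVec v.ofLp v.ofLp) α
      ((1 / 2 : ℝ) • (a + b)) := by
    refine IsFeasible.stretch hf hα.le hr.le (inv_mul_cancel₀ (norm_ne_zero_iff.mpr hv0)).le ?_ ?_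
    · convert hAf using 1
      rw [hv]
      module
    · convert hBf using 1
      rw [hv]
      module
  have hpsd : (‖v‖⁻¹ • Matrix.vecMulVec v.ofLp v.ofLp).PosSemidef :=
    (Matrix.posSemidef_vecMulVec_self_star v.ofLp).smul hr.le
  have hlt := hA.det_lt_det_add hpsd (smul_ne_zero hr.ne' fun h => hv0 (by
    rw [Matrix.vecMulVec_eq_zero] at h
    ext i
    rcases h with h | h <;> simp [h]))
  have hle := hAmax _ _ _ (hA.add_posSemidef hpsd) hα hfeas
  exact absurd (le_of_mul_le_mul_left hle hαs) (not_le.mpr hlt)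

/-- **Existence and uniqueness of the John `s`-ellipsoid.** -/
theorem john_sellipsoid_exists_unique (d : ℕ) (hd : 1 ≤ d) (s : ℝ) (hs : 0 < s)
    (f : Ed d → ℝ) (hf : ProperLogConcave f) :
    ∃! p : Matrix (Fin d) (Fin d) ℝ × ℝ × Ed d,
      IsJohn s f p.1 p.2.1 p.2.2 := by
  obtain ⟨A, α, a, h⟩ := exists_isJohn hs hf
  refine ⟨(A, α, a), h, ?_⟩
  rintro ⟨B, β, b⟩ h'
  obtain ⟨rfl, rfl, rfl⟩ := IsJohn.unique hs hf.1 h' h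
  rfl
end
end

section
/- Let d ≥ 1, let f be an upper semi-continuous log-concave function on ℝ^d with 0 < ∫_{ℝ^d} f < ∞, and let K̄ = {(x,ξ) ∈ ℝ^{d+1} : |ξ| ≤ f(x)/2} be the symmetrized subgraph of f. Assume the closed Euclidean unit ball B^{d+1} of ℝ^{d+1} is contained in K̄. Then the following are equivalent: (1) B^{d+1} is the unique ellipsoid of maximal (d+1)-dimensional Lebesgue volume among all d-symmetric ellipsoids contained in K̄; (2) there exist k ≥ 1, contact points ū_1, …, ū_k ∈ ∂B^{d+1} ∩ ∂K̄ and positive reals c_1, …, c_k such that Σ_{i=1}^k c_i ū_i ⊗ ū_i = Ī and Σ_{i=1}^k c_i u_i = 0, where u_i is the orthogonal projection of ū_i onto ℝ^d and Ī is the (d+1)×(d+1) identity matrix. -/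
open MeasureTheory
open scoped BigOperators RealInnerProductSpace

noncomputable section

theorem IsCompact.convexHull_of_finiteDimensional {E : Type*} [NormedAddCommGroup E]
    [NormedSpace ℝ E] [FiniteDimensional ℝ E] {s : Set E} (hs : IsCompact s) :
    IsCompact (convexHull ℝ s) := by
  rcases s.eq_empty_or_nonempty with rfl | ⟨x₀, hx₀⟩
  · simp
  let N := Module.finrank ℝ E + 1
  have himage : convexHull ℝ s = (fun p : (Fin N → ℝ) × (Fin N → E) => ∑ i, p.1 i • p.2 i) ''
      (stdSimplex ℝ (Fin N) ×ˢ Set.univ.pi fun _ => s) := by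
    ext x
    constructor
    · intro hx
      obtain ⟨ι, _, z, w, hz, hind, hw, hw1, rfl⟩ := eq_pos_convex_span_of_mem_convexHull hx
      have hcard : Fintype.card ι ≤ N := hind.card_le_finrank_succ.trans
        (Nat.succ_le_succ (Submodule.finrank_le _))
      obtain ⟨e⟩ : Nonempty (ι ↪ Fin N) :=
        Function.Embedding.nonempty_of_card_le (by simpa using hcard)
      have hout : ∀ j, j ∉ Set.range e → Function.extend e w 0 j = 0 := fun j hj =>
        Function.extend_apply' _ _ _ hj
      refine ⟨(Function.extend e w 0, Function.extend e z fun _ => x₀), ⟨⟨fun j => ?_, ?_⟩, ?_⟩, ?_⟩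
      · by_cases hj : j ∈ Set.range e
        · obtain ⟨i, rfl⟩ := hj
          simpa [e.injective.extend_apply] using (hw i).le
        · exact (hout j hj).ge
      · rw [← hw1]
        exact (Fintype.sum_of_injective e e.injective _ _ hout
          fun i => (e.injective.extend_apply _ _ _).symm).symm
      · intro j _
        by_cases hj : j ∈ Set.range e
        · obtain ⟨i, rfl⟩ := hj
          simpa [e.injective.extend_apply] using hz ⟨i, rfl⟩
        · simpa [Function.extend_apply' _ _ _ hj] using hx₀
      · refine (Fintype.sum_of_injective e e.injective _ _ (fun j hj => ?_) fun i => ?_).symm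
        · simp [hout j hj]
        · simp [e.injective.extend_apply]
    · rintro ⟨⟨w, z⟩, ⟨⟨hw, hw1⟩, hz⟩, rfl⟩
      exact (convex_convexHull ℝ s).sum_mem (fun i _ => hw i) hw1
        fun i _ => subset_convexHull ℝ s (hz i trivial)
  rw [himage]
  refine ((isCompact_stdSimplex ℝ (Fin N)).prod (isCompact_univ_pi fun _ => hs)).image ?_
  fun_prop

theorem Matrix.PosDef.log_det_le {n : Type*} [Fintype n] [DecidableEq n] {A : Matrix n n ℝ}
    (hA : A.PosDef) : Real.log A.det ≤ A.trace - Fintype.card n := by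
  rw [hA.isHermitian.det_eq_prod_eigenvalues, hA.isHermitian.trace_eq_sum_eigenvalues]
  simp only [RCLike.ofReal_real_eq_id, id]
  rw [Real.log_prod fun i _ => (hA.eigenvalues_pos i).ne']
  calc _ ≤ ∑ i, (hA.isHermitian.eigenvalues i - 1) :=
        Finset.sum_le_sum fun i _ => Real.log_le_sub_one_of_pos (hA.eigenvalues_pos i)
    _ = _ := by simp

theorem Matrix.PosDef.eq_one_of_log_det_eq {n : Type*} [Fintype n] [DecidableEq n]
    {A : Matrix n n ℝ} (hA : A.PosDef) (h : Real.log A.det = A.trace - Fintype.card n) :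
    A = 1 := by
  rw [hA.isHermitian.det_eq_prod_eigenvalues, hA.isHermitian.trace_eq_sum_eigenvalues] at h
  simp only [RCLike.ofReal_real_eq_id, id] at h
  rw [Real.log_prod fun i _ => (hA.eigenvalues_pos i).ne'] at h
  have hsum : ∑ i, (hA.isHermitian.eigenvalues i - 1 - Real.log (hA.isHermitian.eigenvalues i))
      = 0 := by
    simp [h]
  have heig : ∀ i, hA.isHermitian.eigenvalues i = 1 := by
    intro i
    by_contra hne
    have h0 := (Finset.sum_eq_zero_iff_of_nonneg fun i _ => sub_nonneg.2
      (Real.log_le_sub_one_of_pos (hA.eigenvalues_pos i))).1 hsum i (Finset.mem_univ i)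
    linarith [Real.log_lt_sub_one_of_pos (hA.eigenvalues_pos i) hne]
  have hspec := hA.isHermitian.spectral_theorem
  rw [show (RCLike.ofReal ∘ hA.isHermitian.eigenvalues : n → ℝ) = fun _ => 1 from
    funext fun i => by simp [heig i], Matrix.diagonal_one, map_one] at hspec
  exact hspec

theorem isCompact_unitBallE (d : ℕ) : IsCompact (unitBallE d) := by
  refine Metric.isCompact_of_isClosed_isBounded
    (isClosed_le (by fun_prop) continuous_const) ?_
  refine (Metric.isBounded_closedBall (x := (0 : Ed d × ℝ)) (r := 1)).subset fun p hp => ?_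
  have hp' : ‖p.1‖ ^ 2 + p.2 ^ 2 ≤ 1 := hp
  rw [mem_closedBall_zero_iff, Prod.norm_def, max_le_iff, Real.norm_eq_abs]
  exact ⟨by nlinarith [sq_nonneg p.2, norm_nonneg p.1], by
    rw [abs_le_one_iff_mul_self_le_one]; nlinarith [sq_nonneg ‖p.1‖]⟩

theorem mem_interior_unitBallE {d : ℕ} {p : Ed d × ℝ} (hp : ‖p.1‖ ^ 2 + p.2 ^ 2 < 1) :
    p ∈ interior (unitBallE d) :=
  mem_interior.2 ⟨{q | ‖q.1‖ ^ 2 + q.2 ^ 2 < 1}, fun q hq => show ‖q.1‖ ^ 2 + q.2 ^ 2 ≤ 1 from le_of_lt hq,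
    isOpen_lt (by fun_prop) continuous_const, hp⟩

theorem sq_add_sq_eq_one_of_mem_frontier {d : ℕ} {p : Ed d × ℝ}
    (hp : p ∈ frontier (unitBallE d)) : ‖p.1‖ ^ 2 + p.2 ^ 2 = 1 := by
  rw [(isCompact_unitBallE d).isClosed.frontier_eq] at hp
  exact le_antisymm hp.1 (not_lt.1 fun h => hp.2 (mem_interior_unitBallE h))

instance (d : ℕ) : (volume : Measure (Ed d × ℝ)).IsAddHaarMeasure :=
  inferInstanceAs (Measure.IsAddHaarMeasure ((volume : Measure (Ed d)).prod (volume : Measure ℝ)))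

theorem volume_unitBallE_ne_zero (d : ℕ) : volume (unitBallE d) ≠ 0 :=
  (Measure.measure_pos_of_nonempty_interior _
    ⟨(0 : Ed d × ℝ), mem_interior_unitBallE (by simp)⟩).ne'

theorem ellE_eq_image {d : ℕ} (A : Matrix (Fin d) (Fin d) ℝ) (α : ℝ) (a : Ed d) :
    ellE A α a = (fun p => p + (a, (0 : ℝ))) ''
      (((Matrix.toEuclideanLin A).prodMap (α • LinearMap.id : ℝ →ₗ[ℝ] ℝ)) '' unitBallE d) := by
  ext ⟨x, ξ⟩
  simp only [ellE, unitBallE, Set.mem_image, Prod.exists, Set.mem_ofPred_eq]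
  constructor
  · rintro ⟨y, t, h, rfl, rfl⟩
    exact ⟨_, _, ⟨y, t, h, rfl⟩, by simp⟩
  · rintro ⟨_, _, ⟨y, t, h, h'⟩, h''⟩
    refine ⟨y, t, h, ?_⟩
    simp only [LinearMap.prodMap_apply, Prod.mk.injEq, Prod.mk_add_mk] at h' h''
    simp only [← h''.1, ← h''.2, ← h'.1, ← h'.2]
    simp

theorem volume_ellE {d : ℕ} {A : Matrix (Fin d) (Fin d) ℝ} {α : ℝ} (a : Ed d)
    (hA : 0 < A.det) (hα : 0 < α) :
    volume (ellE A α a) = ENNReal.ofReal (A.det * α) * volume (unitBallE d) := by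
  have hdet : LinearMap.det (Matrix.toEuclideanLin A) = A.det := by
    change LinearMap.det (Matrix.toLpLin 2 2 A) = _
    rw [Matrix.toLpLin_eq_toLin, LinearMap.det_toLin]
  rw [ellE_eq_image, Set.image_add_right, measure_preimage_add_right,
    Measure.addHaar_image_linearMap, LinearMap.det_prodMap, hdet]
  simp [abs_of_pos hA, abs_of_pos hα]

theorem volume_ellE_le_iff {d : ℕ} {A : Matrix (Fin d) (Fin d) ℝ} {α : ℝ} (a : Ed d)
    (hA : 0 < A.det) (hα : 0 < α) :
    volume (ellE A α a) ≤ volume (unitBallE d) ↔ A.det * α ≤ 1 := by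
  rw [volume_ellE a hA hα, ← ENNReal.ofReal_le_one]
  conv_lhs => rhs; rw [← one_mul (volume (unitBallE d))]
  exact ENNReal.mul_le_mul_iff_left (volume_unitBallE_ne_zero d)
    (isCompact_unitBallE d).measure_lt_top.ne

theorem volume_ellE_eq_iff {d : ℕ} {A : Matrix (Fin d) (Fin d) ℝ} {α : ℝ} (a : Ed d)
    (hA : 0 < A.det) (hα : 0 < α) :
    volume (ellE A α a) = volume (unitBallE d) ↔ A.det * α = 1 := by
  rw [volume_ellE a hA hα, ← ENNReal.ofReal_eq_one]
  conv_lhs => rhs; rw [← one_mul (volume (unitBallE d))]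
  exact ENNReal.mul_left_inj (volume_unitBallE_ne_zero d)
    (isCompact_unitBallE d).measure_lt_top.ne

/-- The symmetrized subgraph of `f`. -/
def symSubgraph {d : ℕ} (f : Ed d → ℝ) : Set (Ed d × ℝ) := {p | |p.2| ≤ f p.1 / 2}

theorem IsLogConcave.rpow_mul_rpow_le_of_mem_frontier {d : ℕ} {f : Ed d → ℝ}
    (hf : IsLogConcave f) (hB : unitBallE d ⊆ symSubgraph f) {p : Ed d × ℝ}
    (hp : p ∈ frontier (symSubgraph f)) (x : Ed d) {t : ℝ} (ht0 : 0 < t) (ht1 : t < 1) :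
    (f x / 2) ^ t * √(1 - ‖(1 - t)⁻¹ • (p.1 - t • x)‖ ^ 2) ^ (1 - t) ≤ |p.2| := by
  have ht : 0 < 1 - t := sub_pos.2 ht1
  have hclosed : IsClosed {q : Ed d × ℝ |
      (f x / 2) ^ t * √(1 - ‖(1 - t)⁻¹ • (q.1 - t • x)‖ ^ 2) ^ (1 - t) ≤ |q.2|} := by
    refine isClosed_le (continuous_const.mul ?_) (by fun_prop)
    exact Continuous.rpow_const (by fun_prop) fun _ => Or.inr ht.le
  rw [frontier_eq_closure_inter_closure] at hp
  refine closure_minimal (fun q hq => ?_) hclosed hp.2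
  have hq' : f q.1 / 2 < |q.2| := not_le.1 hq
  change (f x / 2) ^ t * √(1 - ‖(1 - t)⁻¹ • (q.1 - t • x)‖ ^ 2) ^ (1 - t) ≤ |q.2|
  set y := (1 - t)⁻¹ • (q.1 - t • x) with hy
  have hqy : t • x + (1 - t) • y = q.1 := by
    rw [hy, smul_smul, mul_inv_cancel₀ ht.ne', one_smul]; abel
  have hsqrt : √(1 - ‖y‖ ^ 2) ≤ f y / 2 := by
    rcases le_or_gt (‖y‖ ^ 2) 1 with h | h
    · have hmem : (y, √(1 - ‖y‖ ^ 2)) ∈ unitBallE d := by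
        change ‖y‖ ^ 2 + √(1 - ‖y‖ ^ 2) ^ 2 ≤ 1
        rw [Real.sq_sqrt (by linarith)]; linarith
      exact (le_abs_self _).trans (hB hmem)
    · rw [Real.sqrt_eq_zero_of_nonpos (by linarith)]
      linarith [hf.1 y]
  calc (f x / 2) ^ t * √(1 - ‖y‖ ^ 2) ^ (1 - t)
      ≤ (f x / 2) ^ t * (f y / 2) ^ (1 - t) :=
        mul_le_mul_of_nonneg_left (Real.rpow_le_rpow (Real.sqrt_nonneg _) hsqrt ht.le)
          (Real.rpow_nonneg (by linarith [hf.1 x]) _)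
    _ = f x ^ t * f y ^ (1 - t) / 2 := by
        rw [Real.div_rpow (hf.1 x) zero_le_two, Real.div_rpow (hf.1 y) zero_le_two,
          div_mul_div_comm, ← Real.rpow_add zero_lt_two]
        simp
    _ ≤ f q.1 / 2 := by
        rw [← hqy]
        linarith [hf.2 x y t ht0.le ht1.le]
    _ ≤ |q.2| := hq'.le

theorem one_sub_norm_sq_eq {E : Type*} [NormedAddCommGroup E] [InnerProductSpace ℝ E]
    (u x : E) {h t : ℝ} (hu : ‖u‖ ^ 2 + h ^ 2 = 1) (ht : t < 1) :
    1 - ‖(1 - t)⁻¹ • (u - t • x)‖ ^ 2 =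
      (h ^ 2 + 2 * (⟪u, x⟫ - 1) * t + (1 - ‖x‖ ^ 2) * t ^ 2) / (1 - t) ^ 2 := by
  have ht' : 1 - t ≠ 0 := (sub_pos.2 ht).ne'
  rw [norm_smul, mul_pow, norm_sub_sq_real, inner_smul_right, norm_smul, mul_pow,
    Real.norm_eq_abs, Real.norm_eq_abs, sq_abs, sq_abs]
  field_simp
  linear_combination (-1 : ℝ) * hu

theorem IsLogConcave.inner_le_one_of_mem_frontier {d : ℕ} {f : Ed d → ℝ}
    (hf : IsLogConcave f) (hB : unitBallE d ⊆ symSubgraph f) {u : Ed d}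
    (hp : (u, (0 : ℝ)) ∈ frontier (symSubgraph f)) (hu : ‖u‖ = 1) {x : Ed d} (hx : 0 < f x) :
    ⟪u, x⟫ ≤ 1 := by
  have hu' : ‖u‖ ^ 2 + (0 : ℝ) ^ 2 = 1 := by simp [hu]
  have key : ∀ t ∈ Set.Ioo (0 : ℝ) 1, 2 * (⟪u, x⟫ - 1) + (1 - ‖x‖ ^ 2) * t ≤ 0 := by
    rintro t ⟨ht0, ht1⟩
    by_contra! hpos
    have h := hf.rpow_mul_rpow_le_of_mem_frontier hB hp x ht0 ht1
    rw [one_sub_norm_sq_eq u x hu' ht1] at h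
    have h1 : 0 < (0 ^ 2 + 2 * (⟪u, x⟫ - 1) * t + (1 - ‖x‖ ^ 2) * t ^ 2) / (1 - t) ^ 2 := by
      refine div_pos ?_ (pow_pos (sub_pos.2 ht1) 2)
      nlinarith
    have h2 := mul_pos (Real.rpow_pos_of_pos (half_pos hx) t)
      (Real.rpow_pos_of_pos (Real.sqrt_pos.2 h1) (1 - t))
    simp only [abs_zero] at h
    linarith
  have hlim : Filter.Tendsto (fun t : ℝ => 2 * (⟪u, x⟫ - 1) + (1 - ‖x‖ ^ 2) * t)
      (nhdsWithin 0 (Set.Ioi 0)) (nhds (2 * (⟪u, x⟫ - 1) + (1 - ‖x‖ ^ 2) * 0)) :=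
    (Continuous.tendsto (by fun_prop) 0).mono_left nhdsWithin_le_nhds
  have := le_of_tendsto hlim
    (Filter.eventually_of_mem (Ioo_mem_nhdsGT zero_lt_one) key)
  linarith

theorem HasDerivAt.nonpos_of_le_right {g : ℝ → ℝ} {g' x : ℝ} (hg : HasDerivAt g g' x)
    (h : ∀ᶠ t in nhdsWithin x (Set.Ioi x), g t ≤ g x) : g' ≤ 0 := by
  have hslope : Filter.Tendsto (slope g x) (nhdsWithin x (Set.Ioi x)) (nhds g') :=
    hg.tendsto_slope.mono_left (nhdsWithin_mono x fun y (hy : x < y) => hy.ne')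
  refine le_of_tendsto hslope ?_
  filter_upwards [h, self_mem_nhdsWithin] with t ht hxt
  rw [slope_def_field]
  exact div_nonpos_of_nonpos_of_nonneg (sub_nonpos.2 ht) (sub_nonneg.2 (le_of_lt hxt))

theorem IsLogConcave.log_le_of_mem_frontier {d : ℕ} {f : Ed d → ℝ}
    (hf : IsLogConcave f) (hB : unitBallE d ⊆ symSubgraph f) {u : Ed d} {h : ℝ}
    (hp : (u, h) ∈ frontier (symSubgraph f)) (hu : ‖u‖ ^ 2 + h ^ 2 = 1) (hh : h ≠ 0)
    {x : Ed d} (hx : 0 < f x) :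
    Real.log (f x / 2) ≤ Real.log |h| - (⟪u, x⟫ - ‖u‖ ^ 2) / h ^ 2 := by
  have hh2 : 0 < h ^ 2 := by positivity
  have hlogh : Real.log (h ^ 2) = 2 * Real.log |h| := by
    rw [Real.log_pow, Real.log_abs]; norm_num
  let P : ℝ → ℝ := fun t => h ^ 2 + 2 * (⟪u, x⟫ - 1) * t + (1 - ‖x‖ ^ 2) * t ^ 2
  have hP0 : P 0 = h ^ 2 := by simp [P]
  let G : ℝ → ℝ := fun t =>
    t * Real.log (f x / 2) + (1 - t) * (Real.log (P t) / 2 - Real.log (1 - t))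
  have hG0 : G 0 = Real.log |h| := by
    simp only [G, hP0, hlogh]; simp
  have hP : HasDerivAt P (2 * (⟪u, x⟫ - 1)) 0 := by
    have h1 := (((hasDerivAt_id (0 : ℝ)).const_mul (2 * (⟪u, x⟫ - 1))).const_add (h ^ 2)).add
      (((hasDerivAt_id (0 : ℝ)).pow 2).const_mul (1 - ‖x‖ ^ 2))
    exact HasDerivAt.congr_deriv (f := P) h1 (by simp)
  have hG : HasDerivAt G (Real.log (f x / 2) - Real.log |h| + (⟪u, x⟫ - ‖u‖ ^ 2) / h ^ 2) 0 := by
    have hid := hasDerivAt_id (0 : ℝ)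
    have hsub := hid.const_sub 1
    have h1 := (hid.mul_const (Real.log (f x / 2))).add (hsub.mul
      (((hP.log (by rw [hP0]; exact hh2.ne')).div_const 2).sub (hsub.log (by simp))))
    refine HasDerivAt.congr_deriv (f := G) h1 ?_
    simp only [Pi.sub_apply, hP0, hlogh, id]
    have : ‖u‖ ^ 2 = 1 - h ^ 2 := by linarith
    rw [this]
    field_simp
    simp
    ring
  have hPpos : ∀ᶠ t in nhdsWithin (0 : ℝ) (Set.Ioi 0), 0 < P t :=
    nhdsWithin_le_nhds (hP.continuousAt.eventually (lt_mem_nhds (by rw [hP0]; exact hh2)))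
  have hle := hG.nonpos_of_le_right (by
    filter_upwards [hPpos, Ioo_mem_nhdsGT zero_lt_one] with t hPt ⟨ht0, ht1⟩
    have ht : 0 < 1 - t := sub_pos.2 ht1
    have hineq := hf.rpow_mul_rpow_le_of_mem_frontier hB hp x ht0 ht1
    rw [one_sub_norm_sq_eq u x hu ht1] at hineq
    have h1 : 0 < P t / (1 - t) ^ 2 := by positivity
    have h2 : 0 < √(P t / (1 - t) ^ 2) := Real.sqrt_pos.2 h1
    have hlog := Real.log_le_log (mul_pos (Real.rpow_pos_of_pos (half_pos hx) t)
      (Real.rpow_pos_of_pos h2 (1 - t))) hineq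
    rw [Real.log_mul (Real.rpow_pos_of_pos (half_pos hx) t).ne'
      (Real.rpow_pos_of_pos h2 (1 - t)).ne', Real.log_rpow (half_pos hx), Real.log_rpow h2,
      Real.log_sqrt h1.le, Real.log_div hPt.ne' (by positivity), Real.log_pow] at hlog
    rw [hG0]
    refine le_of_eq_of_le ?_ hlog
    simp only [G]
    push_cast
    ring)
  linarith

theorem IsLogConcave.inner_add_log_le_of_ellE_subset {d : ℕ} {f : Ed d → ℝ}
    (hf : IsLogConcave f) (hB : unitBallE d ⊆ symSubgraph f) {p : Ed d × ℝ}
    (hpB : p ∈ frontier (unitBallE d)) (hp : p ∈ frontier (symSubgraph f))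
    {A : Matrix (Fin d) (Fin d) ℝ} {α : ℝ} {a : Ed d} (hα : 0 < α)
    (hE : ellE A α a ⊆ symSubgraph f) :
    ⟪p.1, Matrix.toEuclideanLin A p.1⟫ + ⟪p.1, a⟫ - ‖p.1‖ ^ 2 + p.2 ^ 2 * Real.log α ≤ 0 := by
  have hu := sq_add_sq_eq_one_of_mem_frontier hpB
  obtain ⟨u, h⟩ := p
  dsimp only at hu ⊢
  have hmem : ∀ (y : Ed d) (t : ℝ), ‖y‖ ^ 2 + t ^ 2 ≤ 1 →
      |α * t| ≤ f (Matrix.toEuclideanLin A y + a) / 2 := by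
    intro y t hyt
    have hq : (Matrix.toEuclideanLin A y + a, α * t) ∈ ellE A α a := by
      refine ⟨y, t, hyt, ?_⟩
      simp
    exact hE hq
  rcases eq_or_ne h 0 with rfl | hh
  · have hu1 : ‖u‖ = 1 := by
      rw [← sq_eq_sq₀ (norm_nonneg u) zero_le_one]; linarith
    have key : ∀ s ∈ Set.Ioo (0 : ℝ) 1,
        s * ⟪u, Matrix.toEuclideanLin A u⟫ + ⟪u, a⟫ ≤ 1 := by
      rintro s ⟨hs0, hs1⟩
      have hs : 0 < 1 - s ^ 2 := by nlinarith
      have h1 := hmem (s • u) √(1 - s ^ 2) (by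
        rw [norm_smul, mul_pow, Real.norm_eq_abs, sq_abs, hu1, Real.sq_sqrt hs.le]; linarith)
      have h2 : 0 < |α * √(1 - s ^ 2)| :=
        abs_pos.2 (mul_pos hα (Real.sqrt_pos.2 hs)).ne'
      have h3 := hf.inner_le_one_of_mem_frontier hB hp hu1
        (x := Matrix.toEuclideanLin A (s • u) + a) (by linarith)
      rwa [inner_add_right, map_smul, inner_smul_right] at h3
    have hlim : Filter.Tendsto
        (fun s : ℝ => s * ⟪u, Matrix.toEuclideanLin A u⟫ + ⟪u, a⟫)
        (nhdsWithin 1 (Set.Iio 1)) (nhds (1 * ⟪u, Matrix.toEuclideanLin A u⟫ + ⟪u, a⟫)) :=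
      (Continuous.tendsto (by fun_prop) 1).mono_left nhdsWithin_le_nhds
    have := le_of_tendsto hlim
      (Filter.eventually_of_mem (Ioo_mem_nhdsLT zero_lt_one) key)
    rw [hu1]
    linarith
  · have hh2 : 0 < h ^ 2 := by positivity
    have h1 := hmem u h hu.le
    rw [abs_mul, abs_of_pos hα] at h1
    have h2 : 0 < α * |h| := mul_pos hα (abs_pos.2 hh)
    have h3 := hf.log_le_of_mem_frontier hB hp hu hh
      (x := Matrix.toEuclideanLin A u + a) (by linarith)
    have h4 := (Real.log_le_log h2 h1).trans h3
    rw [Real.log_mul hα.ne' (abs_pos.2 hh).ne', inner_add_right] at h4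
    have h5 : Real.log α ≤
        -(⟪u, Matrix.toEuclideanLin A u⟫ + ⟪u, a⟫ - ‖u‖ ^ 2) / h ^ 2 := by
      rw [neg_div]; linarith
    rw [le_div_iff₀ hh2] at h5
    linarith

theorem augVec_castSucc {d : ℕ} (p : Ed d × ℝ) (i : Fin d) : augVec p i.castSucc = p.1 i := by
  simp [augVec]

theorem augVec_last {d : ℕ} (p : Ed d × ℝ) : augVec p (Fin.last d) = p.2 := by
  simp [augVec]

theorem sum_vecMulVec_augVec_eq_one_iff {d : ℕ} {ι : Type*} [Fintype ι] (u : ι → Ed d × ℝ)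
    (c : ι → ℝ) :
    (∑ i, c i • Matrix.vecMulVec (augVec (u i)) (augVec (u i))) =
        (1 : Matrix (Fin (d + 1)) (Fin (d + 1)) ℝ) ↔
      (∀ a b, ∑ i, c i * ((u i).1 a * (u i).1 b) = (1 : Matrix (Fin d) (Fin d) ℝ) a b) ∧
        (∀ a, ∑ i, c i * ((u i).1 a * (u i).2) = 0) ∧ ∑ i, c i * (u i).2 ^ 2 = 1 := by
  have hentry : ∀ a b, (∑ i, c i • Matrix.vecMulVec (augVec (u i)) (augVec (u i))) a b =
      ∑ i, c i * (augVec (u i) a * augVec (u i) b) := fun a b => by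
    simp [Matrix.sum_apply, Matrix.vecMulVec_apply]
  constructor
  · intro h
    refine ⟨fun a b => ?_, fun a => ?_, ?_⟩
    · have := hentry a.castSucc b.castSucc
      rw [h] at this
      simpa [augVec_castSucc, Matrix.one_apply] using this.symm
    · have := hentry a.castSucc (Fin.last d)
      rw [h] at this
      simpa [augVec_castSucc, augVec_last, Matrix.one_apply, (Fin.castSucc_lt_last a).ne]
        using this.symm
    · have := hentry (Fin.last d) (Fin.last d)
      rw [h] at this
      simpa [augVec_last, sq] using this.symm
  · rintro ⟨h1, h2, h3⟩
    ext a b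
    rw [hentry]
    induction a using Fin.lastCases with
    | last =>
      induction b using Fin.lastCases with
      | last => simpa [augVec_last, sq] using h3
      | cast b =>
        simpa [augVec_castSucc, augVec_last, Matrix.one_apply, (Fin.castSucc_lt_last b).ne',
          mul_comm] using h2 b
    | cast a =>
      induction b using Fin.lastCases with
      | last =>
        simpa [augVec_castSucc, augVec_last, Matrix.one_apply, (Fin.castSucc_lt_last a).ne]
          using h2 a
      | cast b => simpa [augVec_castSucc, Matrix.one_apply] using h1 a b

theorem inner_toEuclideanLin {d : ℕ} (A : Matrix (Fin d) (Fin d) ℝ) (x : Ed d) :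
    ⟪x, Matrix.toEuclideanLin A x⟫ = ∑ a, ∑ b, A a b * (x a * x b) := by
  simp only [PiLp.inner_apply, Matrix.toLpLin_apply, Matrix.mulVec, dotProduct]
  refine Finset.sum_congr rfl fun a _ => ?_
  simp only [RCLike.inner_apply, conj_trivial, Finset.sum_mul]
  exact Finset.sum_congr rfl fun b _ => by ring

theorem sum_mul_inner_toEuclideanLin {d : ℕ} {ι : Type*} [Fintype ι] {x : ι → Ed d}
    {c : ι → ℝ}
    (h : ∀ a b, ∑ i, c i * (x i a * x i b) = (1 : Matrix (Fin d) (Fin d) ℝ) a b)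
    (A : Matrix (Fin d) (Fin d) ℝ) :
    ∑ i, c i * ⟪x i, Matrix.toEuclideanLin A (x i)⟫ = A.trace := by
  simp only [inner_toEuclideanLin, Finset.mul_sum]
  rw [Finset.sum_comm]
  refine Finset.sum_congr rfl fun a _ => ?_
  rw [Finset.sum_comm]
  calc ∑ b, ∑ i, c i * (A a b * (x i a * x i b))
      = ∑ b, A a b * ∑ i, c i * (x i a * x i b) := by
        refine Finset.sum_congr rfl fun b _ => ?_
        rw [Finset.mul_sum]
        exact Finset.sum_congr rfl fun i _ => by ring
    _ = A.diag a := by simp [h, Matrix.one_apply]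

theorem sum_mul_norm_sq {d : ℕ} {ι : Type*} [Fintype ι] {x : ι → Ed d} {c : ι → ℝ}
    (h : ∀ a b, ∑ i, c i * (x i a * x i b) = (1 : Matrix (Fin d) (Fin d) ℝ) a b) :
    ∑ i, c i * ‖x i‖ ^ 2 = d := by
  have h1 := sum_mul_inner_toEuclideanLin h 1
  simpa [real_inner_self_eq_norm_sq] using h1

theorem eq_zero_of_inner_eq_zero {d : ℕ} {ι : Type*} [Fintype ι] {x : ι → Ed d} {c : ι → ℝ}
    (h : ∀ a b, ∑ i, c i * (x i a * x i b) = (1 : Matrix (Fin d) (Fin d) ℝ) a b) {v : Ed d}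
    (hv : ∀ i, ⟪x i, v⟫ = 0) : v = 0 := by
  ext b
  calc v b = ∑ a, (∑ i, c i * (x i b * x i a)) * v a := by simp [h, Matrix.one_apply]
    _ = ∑ i, c i * x i b * ⟪x i, v⟫ := by
      simp only [PiLp.inner_apply, RCLike.inner_apply, conj_trivial, Finset.mul_sum,
        Finset.sum_mul]
      rw [Finset.sum_comm]
      exact Finset.sum_congr rfl fun i _ => Finset.sum_congr rfl fun a _ => by ring
    _ = (0 : Ed d) b := by simp [hv]

theorem IsLogConcave.unitBallE_unique_maximal {d : ℕ} {f : Ed d → ℝ} (hf : IsLogConcave f)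
    (hB : unitBallE d ⊆ symSubgraph f) {ι : Type*} [Fintype ι] {u : ι → Ed d × ℝ} {c : ι → ℝ}
    (hu : ∀ i, u i ∈ frontier (unitBallE d) ∩ frontier (symSubgraph f)) (hc : ∀ i, 0 < c i)
    (hI : (∑ i, c i • Matrix.vecMulVec (augVec (u i)) (augVec (u i))) =
      (1 : Matrix (Fin (d + 1)) (Fin (d + 1)) ℝ))
    (h0 : ∑ i, c i • (u i).1 = 0)
    {A : Matrix (Fin d) (Fin d) ℝ} {α : ℝ} {a : Ed d} (hA : A.PosDef) (hα : 0 < α)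
    (hE : ellE A α a ⊆ symSubgraph f) :
    A.det * α ≤ 1 ∧ (A.det * α = 1 → A = 1 ∧ α = 1 ∧ a = 0) := by
  obtain ⟨h1, -, h3⟩ := (sum_vecMulVec_augVec_eq_one_iff u c).1 hI
  have hle : ∀ i, c i * (⟪(u i).1, Matrix.toEuclideanLin A (u i).1⟫ + ⟪(u i).1, a⟫ -
      ‖(u i).1‖ ^ 2 + (u i).2 ^ 2 * Real.log α) ≤ 0 := fun i =>
    mul_nonpos_of_nonneg_of_nonpos (hc i).le
      (hf.inner_add_log_le_of_ellE_subset hB (hu i).1 (hu i).2 hα hE)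
  have hinner : ∑ i, c i * ⟪(u i).1, a⟫ = 0 := by
    rw [← inner_zero_left (𝕜 := ℝ) a, ← h0, sum_inner]
    simp [inner_smul_left]
  have hsum : ∑ i, c i * (⟪(u i).1, Matrix.toEuclideanLin A (u i).1⟫ + ⟪(u i).1, a⟫ -
      ‖(u i).1‖ ^ 2 + (u i).2 ^ 2 * Real.log α) = A.trace - d + Real.log α := by
    have hsplit : ∀ i, c i * (⟪(u i).1, Matrix.toEuclideanLin A (u i).1⟫ + ⟪(u i).1, a⟫ -
        ‖(u i).1‖ ^ 2 + (u i).2 ^ 2 * Real.log α) =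
        c i * ⟪(u i).1, Matrix.toEuclideanLin A (u i).1⟫ + c i * ⟪(u i).1, a⟫ -
          c i * ‖(u i).1‖ ^ 2 + c i * (u i).2 ^ 2 * Real.log α := fun i => by ring
    simp only [hsplit, Finset.sum_add_distrib, Finset.sum_sub_distrib, ← Finset.sum_mul, hinner,
      h3, sum_mul_inner_toEuclideanLin h1, sum_mul_norm_sq h1]
    ring
  have htrace : A.trace - d + Real.log α ≤ 0 := hsum ▸ Finset.sum_nonpos fun i _ => hle i
  have hlogdet := hA.log_det_le
  rw [Fintype.card_fin] at hlogdet
  have hlog : Real.log (A.det * α) = Real.log A.det + Real.log α :=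
    Real.log_mul hA.det_pos.ne' hα.ne'
  have hpos : 0 < A.det * α := mul_pos hA.det_pos hα
  refine ⟨(Real.log_nonpos_iff hpos.le).1 (by linarith), fun heq => ?_⟩
  rw [heq, Real.log_one] at hlog
  obtain rfl : A = 1 := hA.eq_one_of_log_det_eq (by rw [Fintype.card_fin]; linarith)
  have hlogα : Real.log α = 0 := by simpa using hlog.symm
  obtain rfl : α = 1 := Real.eq_one_of_pos_of_log_eq_zero hα hlogα
  refine ⟨rfl, rfl, eq_zero_of_inner_eq_zero h1 fun i => ?_⟩
  have hzero := (Finset.sum_eq_zero_iff_of_nonpos fun i _ => hle i).1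
    (hsum.trans (by simp)) i (Finset.mem_univ i)
  simpa [real_inner_self_eq_norm_sq, (hc i).ne'] using hzero

theorem frontier_inter_frontier_neg {d : ℕ} {f : Ed d → ℝ} {p : Ed d × ℝ}
    (hp : p ∈ frontier (unitBallE d) ∩ frontier (symSubgraph f)) :
    (p.1, -p.2) ∈ frontier (unitBallE d) ∩ frontier (symSubgraph f) := by
  let R : Ed d × ℝ ≃ₜ Ed d × ℝ := (Homeomorph.refl (Ed d)).prodCongr (Homeomorph.neg ℝ)
  have hRB : R ⁻¹' unitBallE d = unitBallE d := by
    ext q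
    change ‖q.1‖ ^ 2 + (-q.2) ^ 2 ≤ 1 ↔ ‖q.1‖ ^ 2 + q.2 ^ 2 ≤ 1
    rw [neg_sq]
  have hRK : R ⁻¹' symSubgraph f = symSubgraph f := by
    ext q
    change |(-q.2)| ≤ f q.1 / 2 ↔ |q.2| ≤ f q.1 / 2
    rw [abs_neg]
  rw [← hRB, ← hRK, ← R.preimage_frontier, ← R.preimage_frontier] at hp
  exact hp

theorem exists_john_decomposition {d : ℕ} {ι : Type*} [Fintype ι] {C : Set (Ed d × ℝ)}
    (hneg : ∀ p ∈ C, (p.1, -p.2) ∈ C) {p : ι → Ed d × ℝ} {w : ι → ℝ}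
    (hp : ∀ i, p i ∈ C) (hw : ∀ i, 0 < w i) (hw1 : ∑ i, w i = 1)
    (hmat : ∀ a b, ∑ i, w i * ((p i).1 a * (p i).1 b) =
      ((d : ℝ) + 1)⁻¹ * (1 : Matrix (Fin d) (Fin d) ℝ) a b)
    (hlast : ∑ i, w i * (p i).2 ^ 2 = ((d : ℝ) + 1)⁻¹) (hzero : ∑ i, w i • (p i).1 = 0) :
    ∃ (k : ℕ) (u : Fin k → Ed d × ℝ) (c : Fin k → ℝ), 1 ≤ k ∧ (∀ i, u i ∈ C) ∧
      (∀ i, 0 < c i) ∧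
      (∑ i, c i • Matrix.vecMulVec (augVec (u i)) (augVec (u i))) =
        (1 : Matrix (Fin (d + 1)) (Fin (d + 1)) ℝ) ∧
      (∑ i, c i • (u i).1) = 0 := by
  have hd : (0 : ℝ) < d + 1 := by positivity
  let u : ι ⊕ ι → Ed d × ℝ := Sum.elim p fun i => ((p i).1, -(p i).2)
  let c : ι ⊕ ι → ℝ := Sum.elim (fun i => (d + 1) / 2 * w i) fun i => (d + 1) / 2 * w i
  have hu : ∀ i, u i ∈ C := by
    rintro (i | i)
    exacts [hp i, hneg _ (hp i)]
  have hc : ∀ i, 0 < c i := by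
    rintro (i | i) <;> exact mul_pos (half_pos hd) (hw i)
  have hmatrix : (∑ i, c i • Matrix.vecMulVec (augVec (u i)) (augVec (u i))) =
      (1 : Matrix (Fin (d + 1)) (Fin (d + 1)) ℝ) := by
    rw [sum_vecMulVec_augVec_eq_one_iff]
    refine ⟨fun a b => ?_, fun a => ?_, ?_⟩
    · simp only [u, c, Fintype.sum_sum_type, Sum.elim_inl, Sum.elim_inr, mul_assoc,
        ← Finset.mul_sum, hmat]
      field_simp
      ring
    · simp [u, c, Fintype.sum_sum_type]
    · simp only [u, c, Fintype.sum_sum_type, Sum.elim_inl, Sum.elim_inr, mul_assoc, neg_sq,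
        ← Finset.mul_sum, hlast]
      field_simp
      ring
  have hcenter : ∑ i, c i • (u i).1 = 0 := by
    simp [u, c, Fintype.sum_sum_type, mul_smul, ← Finset.smul_sum, hzero]
  have hne : Nonempty ι := by
    by_contra h
    rw [not_nonempty_iff] at h
    simp at hw1
  let e := Fintype.equivFin (ι ⊕ ι)
  refine ⟨Fintype.card (ι ⊕ ι), u ∘ e.symm, c ∘ e.symm, Fintype.card_pos, fun i => hu _,
    fun i => hc _, ?_, ?_⟩
  · rw [← hmatrix]
    exact e.symm.sum_comp fun i => c i • Matrix.vecMulVec (augVec (u i)) (augVec (u i))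
  · rw [← hcenter]
    exact e.symm.sum_comp fun i => c i • (u i).1

/-- The evaluation of a functional at the moments `(x ⊗ x, ξ², x)` of a point `(x, ξ)`. -/
theorem exists_quadratic_of_functional {d : ℕ}
    (l : StrongDual ℝ ((Fin d → Fin d → ℝ) × ℝ × Ed d)) :
    ∃ (H : Matrix (Fin d) (Fin d) ℝ) (η : ℝ) (v : Ed d), H.IsHermitian ∧
      (∀ p : Ed d × ℝ, l (fun a b => p.1 a * p.1 b, p.2 ^ 2, p.1) =
        ⟪p.1, Matrix.toEuclideanLin H p.1⟫ + η * p.2 ^ 2 + ⟪p.1, v⟫) ∧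
      ∀ r : ℝ, l (fun a b => r * (1 : Matrix (Fin d) (Fin d) ℝ) a b, r, 0) =
        r * (H.trace + η) := by
  let L : Matrix (Fin d) (Fin d) ℝ := Matrix.of fun a b =>
    l (Pi.single a (Pi.single b 1), 0, 0)
  let H : Matrix (Fin d) (Fin d) ℝ := (2 : ℝ)⁻¹ • (L + L.transpose)
  let lv : StrongDual ℝ (Ed d) :=
    l.comp ((ContinuousLinearMap.inr ℝ (Fin d → Fin d → ℝ) (ℝ × Ed d)).comp
      (ContinuousLinearMap.inr ℝ ℝ (Ed d)))
  let v : Ed d := (InnerProductSpace.toDual ℝ (Ed d)).symm lv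
  have hv : ∀ x, l (0, 0, x) = ⟪x, v⟫ := fun x => by
    rw [real_inner_comm]
    exact (InnerProductSpace.toDual_symm_apply (y := lv)).symm
  have hη : ∀ r : ℝ, l (0, r, 0) = l (0, 1, 0) * r := fun r => by
    rw [show ((0 : Fin d → Fin d → ℝ), r, (0 : Ed d)) = r • (0, 1, 0) by simp, map_smul,
      smul_eq_mul, mul_comm]
  have hL : ∀ M : Fin d → Fin d → ℝ, l (M, 0, 0) = ∑ a, ∑ b, L a b * M a b := fun M => by
    have hM : M = ∑ a, ∑ b, M a b • Pi.single a (Pi.single b (1 : ℝ)) := by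
      ext a b
      simp [Finset.sum_apply, Pi.single_apply, ite_apply]
    obtain ⟨lM, hlM⟩ : ∃ lM : (Fin d → Fin d → ℝ) →L[ℝ] ℝ, ∀ N, lM N = l (N, 0, 0) :=
      ⟨l.comp (ContinuousLinearMap.inl ℝ (Fin d → Fin d → ℝ) (ℝ × Ed d)), fun N => rfl⟩
    calc l (M, 0, 0) = lM (∑ a, ∑ b, M a b • Pi.single a (Pi.single b (1 : ℝ))) := by
          rw [← hM, hlM]
      _ = ∑ a, ∑ b, M a b * L a b := by
          simp only [map_sum, map_smul, smul_eq_mul]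
          simp only [hlM, L, Matrix.of_apply]
      _ = ∑ a, ∑ b, L a b * M a b := by simp only [mul_comm]
  have hsplit : ∀ (M : Fin d → Fin d → ℝ) (r : ℝ) (x : Ed d),
      l (M, r, x) = (∑ a, ∑ b, L a b * M a b) + l (0, 1, 0) * r + ⟪x, v⟫ := fun M r x => by
    rw [← hL, ← hη, ← hv, ← map_add, ← map_add]
    simp
  refine ⟨H, l (0, 1, 0), v, ?_, fun p => ?_, fun r => ?_⟩
  · ext a b
    simp [H, add_comm]
  · rw [hsplit, inner_toEuclideanLin]
    congr 2
    have hswap : ∑ a, ∑ b, L b a * (p.1 a * p.1 b) = ∑ a, ∑ b, L a b * (p.1 a * p.1 b) := by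
      rw [Finset.sum_comm]
      exact Finset.sum_congr rfl fun a _ => Finset.sum_congr rfl fun b _ => by ring
    have hH : ∀ a b, H a b * (p.1 a * p.1 b) =
        2⁻¹ * (L a b * (p.1 a * p.1 b) + L b a * (p.1 a * p.1 b)) := fun a b => by
      simp [H]; ring
    simp only [hH, ← Finset.mul_sum, Finset.sum_add_distrib, hswap]
    ring
  · have htrace : H.trace = L.trace := by
      simp only [H, Matrix.trace_smul, Matrix.trace_add, Matrix.trace_transpose, smul_eq_mul]
      ring
    have hone : ∑ a, ∑ b, L a b * (r * (1 : Matrix (Fin d) (Fin d) ℝ) a b) = r * L.trace := by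
      simp [Matrix.one_apply, Matrix.trace, Finset.mul_sum, mul_comm]
    rw [hsplit, hone, htrace, inner_zero_left]
    ring

theorem norm_add_smul_sq {d : ℕ} (x y : Ed d) (ξ η δ : ℝ) :
    ‖x + δ • y‖ ^ 2 + ((1 + δ * η) * ξ) ^ 2 = ‖x‖ ^ 2 + ξ ^ 2 +
      δ * (2 * (⟪x, y⟫ + η * ξ ^ 2) + δ * (‖y‖ ^ 2 + (η * ξ) ^ 2)) := by
  rw [norm_add_sq_real, inner_smul_right, norm_smul, mul_pow, Real.norm_eq_abs, sq_abs]
  ring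

open Filter Topology in
theorem eventually_ellE_subset {d : ℕ} {f : Ed d → ℝ} (hB : unitBallE d ⊆ symSubgraph f)
    {H : Matrix (Fin d) (Fin d) ℝ} {η : ℝ} {v : Ed d}
    (hneg : ∀ p ∈ frontier (unitBallE d) ∩ frontier (symSubgraph f),
      ⟪p.1, Matrix.toEuclideanLin H p.1⟫ + η * p.2 ^ 2 + ⟪p.1, v⟫ < 0) :
    ∀ᶠ δ : ℝ in 𝓝[>] 0, ellE (1 + δ • H) (1 + δ * η) (δ • v) ⊆ symSubgraph f := by
  have hT : Continuous (Matrix.toEuclideanLin H) :=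
    (Matrix.toEuclideanLin H).continuous_of_finiteDimensional
  let Y : Ed d → Ed d := fun x => Matrix.toEuclideanLin H x + v
  have hY : Continuous Y := hT.add continuous_const
  let g : ℝ × (Ed d × ℝ) → Ed d × ℝ := fun z =>
    (z.2.1 + z.1 • Y z.2.1, (1 + z.1 * η) * z.2.2)
  have hg : Continuous g := by fun_prop
  have hlocal : ∀ p ∈ unitBallE d, ∀ᶠ z : ℝ × (Ed d × ℝ) in 𝓝 (0, p),
      0 < z.1 → z.2 ∈ unitBallE d → g z ∈ symSubgraph f := by
    intro p hpB
    by_cases hpK : p ∈ interior (symSubgraph f)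
    · have hg0 : g (0, p) = p := by simp [g]
      have := hg.continuousAt.eventually
        (isOpen_interior.mem_nhds (show g (0, p) ∈ interior (symSubgraph f) by rwa [hg0]))
      filter_upwards [this] with z hz _ _ using interior_subset hz
    · have hpC : p ∈ frontier (unitBallE d) ∩ frontier (symSubgraph f) :=
        ⟨⟨subset_closure hpB, fun h => hpK (interior_mono hB h)⟩,
          ⟨subset_closure (hB hpB), hpK⟩⟩
      let W : ℝ × (Ed d × ℝ) → ℝ := fun z =>
        2 * (⟪z.2.1, Y z.2.1⟫ + η * z.2.2 ^ 2) + z.1 * (‖Y z.2.1‖ ^ 2 + (η * z.2.2) ^ 2)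
      have hW : Continuous W := by fun_prop
      have hW0 : W (0, p) < 0 := by
        have := hneg p hpC
        simp only [W, Y, inner_add_right]
        linarith
      filter_upwards [hW.continuousAt.eventually (gt_mem_nhds hW0)] with z hz hδ hzB
      have hzB' : ‖z.2.1‖ ^ 2 + z.2.2 ^ 2 ≤ 1 := hzB
      refine hB (show ‖(g z).1‖ ^ 2 + (g z).2 ^ 2 ≤ 1 from ?_)
      simp only [g]
      rw [norm_add_smul_sq]
      have : z.1 * W z < 0 := mul_neg_of_pos_of_neg hδ hz
      simp only [W] at this
      linarith
  have hall := (isCompact_unitBallE d).eventually_forall_of_forall_eventually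
    (P := fun δ p => 0 < δ → p ∈ unitBallE d → g (δ, p) ∈ symSubgraph f) hlocal
  filter_upwards [nhdsWithin_le_nhds hall, self_mem_nhdsWithin] with δ hδ hδ0
  rintro ⟨x, ξ⟩ ⟨y, t, hyt, hx, hξ⟩
  have hmem := hδ (y, t) (show ‖y‖ ^ 2 + t ^ 2 ≤ 1 from hyt) hδ0 hyt
  have hgx : g (δ, (y, t)) = (x, ξ) := by
    refine Prod.ext ?_ hξ.symm
    rw [hx]
    simp [g, Y, add_assoc]
  rwa [hgx] at hmem

open Filter Topology in
theorem eventually_one_lt_det_mul {n : Type*} [Fintype n] [DecidableEq n] {H : Matrix n n ℝ}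
    {η : ℝ} (h : 0 < H.trace + η) : ∀ᶠ δ : ℝ in 𝓝[>] 0, 1 < (1 + δ • H).det * (1 + δ * η) := by
  let P := (Matrix.det (1 + (Polynomial.X : Polynomial ℝ) • H.map Polynomial.C)).divX.divX
  let R : ℝ → ℝ := fun δ =>
    H.trace + η + δ * (H.trace * η + P.eval δ + P.eval δ * δ * η)
  have hR : Continuous R := by fun_prop
  have hR0 : 0 < R 0 := by simpa [R] using h
  filter_upwards [nhdsWithin_le_nhds (hR.continuousAt.eventually (lt_mem_nhds hR0)),
    self_mem_nhdsWithin] with δ hδ hδ0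
  have hpos : 0 < δ * R δ := mul_pos hδ0 hδ
  rw [Matrix.det_one_add_smul]
  simp only [R] at hpos
  change 1 < (1 + H.trace * δ + P.eval δ * δ ^ 2) * (1 + δ * η)
  linarith

open Filter Topology in
theorem Matrix.IsHermitian.eventually_posDef_one_add_smul {d : ℕ}
    {H : Matrix (Fin d) (Fin d) ℝ} (hH : H.IsHermitian) :
    ∀ᶠ δ : ℝ in 𝓝[>] 0, (1 + δ • H).PosDef := by
  let T : Ed d →L[ℝ] Ed d := (Matrix.toEuclideanLin H).toContinuousLinearMap
  have hlim : ∀ᶠ δ : ℝ in 𝓝 0, δ * ‖T‖ < 1 :=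
    (Continuous.continuousAt (by fun_prop)).eventually (gt_mem_nhds (by simp))
  filter_upwards [nhdsWithin_le_nhds hlim, self_mem_nhdsWithin] with δ hδ hδ0
  refine Matrix.PosDef.of_dotProduct_mulVec_pos ?_ fun x hx => ?_
  · ext a b
    have := congrFun (congrFun hH a) b
    simp only [Matrix.conjTranspose_apply, star_trivial] at this
    simp [this, Matrix.one_apply, eq_comm]
  · let y : Ed d := WithLp.toLp 2 x
    have hy : 0 < ‖y‖ := norm_pos_iff.2 fun h => hx (by simpa [y] using h)
    have hinner : star x ⬝ᵥ (1 + δ • H).mulVec x = ‖y‖ ^ 2 + δ * ⟪y, T y⟫ := by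
      rw [← real_inner_self_eq_norm_sq, ← inner_smul_right, ← inner_add_right]
      simp [EuclideanSpace.inner_eq_star_dotProduct, y, T, Matrix.add_mulVec,
        Matrix.smul_mulVec, dotProduct_comm]
    have hbound : -(‖T‖ * ‖y‖ ^ 2) ≤ ⟪y, T y⟫ := by
      have h1 := neg_le_of_abs_le (abs_real_inner_le_norm y (T y))
      have h2 := mul_le_mul_of_nonneg_left (T.le_opNorm y) (norm_nonneg y)
      linarith
    rw [hinner]
    have h1 := mul_le_mul_of_nonneg_left hbound (le_of_lt hδ0)
    have h2 := mul_pos (sub_pos.2 hδ) (pow_pos hy 2)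
    linarith

open Filter Topology in
theorem exists_john_decomposition_of_maximal {d : ℕ} {f : Ed d → ℝ}
    (hB : unitBallE d ⊆ symSubgraph f)
    (hmax : ∀ (A : Matrix (Fin d) (Fin d) ℝ) (α : ℝ) (a : Ed d), A.PosDef → 0 < α →
      ellE A α a ⊆ symSubgraph f → A.det * α ≤ 1) :
    ∃ (k : ℕ) (u : Fin k → Ed d × ℝ) (c : Fin k → ℝ), 1 ≤ k ∧
      (∀ i, u i ∈ frontier (unitBallE d) ∩ frontier (symSubgraph f)) ∧ (∀ i, 0 < c i) ∧
      (∑ i, c i • Matrix.vecMulVec (augVec (u i)) (augVec (u i))) =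
        (1 : Matrix (Fin (d + 1)) (Fin (d + 1)) ℝ) ∧
      (∑ i, c i • (u i).1) = 0 := by
  have hd : (0 : ℝ) < d + 1 := by positivity
  set C := frontier (unitBallE d) ∩ frontier (symSubgraph f) with hC
  have hCcomp : IsCompact C :=
    (isCompact_unitBallE d).of_isClosed_subset (isClosed_frontier.inter isClosed_frontier)
      (Set.inter_subset_left.trans (isCompact_unitBallE d).isClosed.frontier_subset)
  let Φ : Ed d × ℝ → (Fin d → Fin d → ℝ) × ℝ × Ed d := fun p =>
    (fun a b => p.1 a * p.1 b, p.2 ^ 2, p.1)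
  have hΦ : Continuous Φ := by fun_prop
  let τ : (Fin d → Fin d → ℝ) × ℝ × Ed d :=
    (fun a b => ((d : ℝ) + 1)⁻¹ * (1 : Matrix (Fin d) (Fin d) ℝ) a b, ((d : ℝ) + 1)⁻¹, 0)
  by_cases hτ : τ ∈ convexHull ℝ (Φ '' C)
  · obtain ⟨ι, _, z, w, hz, -, hw, hw1, hsum⟩ := eq_pos_convex_span_of_mem_convexHull hτ
    choose p hpC hpz using fun i => hz ⟨i, rfl⟩
    simp only [← hpz] at hsum
    refine exists_john_decomposition (fun p hp => frontier_inter_frontier_neg hp) hpC hw hw1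
      (fun a b => ?_) ?_ ?_
    · simpa [Φ, τ, Prod.fst_sum, Finset.sum_apply] using
        congrFun (congrFun (congrArg Prod.fst hsum) a) b
    · simpa [Φ, τ, Prod.fst_sum, Prod.snd_sum] using congrArg (fun q => q.2.1) hsum
    · simpa [Φ, τ, Prod.snd_sum] using congrArg (fun q => q.2.2) hsum
  · exfalso
    obtain ⟨l, s, hls, hsτ⟩ := geometric_hahn_banach_closed_point (convex_convexHull ℝ _)
      (hCcomp.image hΦ).convexHull_of_finiteDimensional.isClosed hτ
    obtain ⟨H, η, v, hH, hl, hlτ⟩ := exists_quadratic_of_functional l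
    have hneg : ∀ p ∈ C, ⟪p.1, Matrix.toEuclideanLin (H - s • 1) p.1⟫ + (η - s) * p.2 ^ 2 +
        ⟪p.1, v⟫ < 0 := by
      intro p hp
      have h1 := hls _ (subset_convexHull ℝ _ ⟨p, hp, rfl⟩)
      have h2 := sq_add_sq_eq_one_of_mem_frontier hp.1
      rw [hl p] at h1
      have h3 : ⟪p.1, Matrix.toEuclideanLin (H - s • 1) p.1⟫ =
          ⟪p.1, Matrix.toEuclideanLin H p.1⟫ - s * ‖p.1‖ ^ 2 := by
        rw [← real_inner_self_eq_norm_sq, ← inner_smul_right, ← inner_sub_right]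
        simp
      rw [h3]
      linear_combination h1 + (-s) * h2
    have htrace : 0 < (H - s • 1).trace + (η - s) := by
      have h1 : s < ((d : ℝ) + 1)⁻¹ * (H.trace + η) := (hlτ _) ▸ hsτ
      rw [inv_mul_eq_div, lt_div_iff₀ hd] at h1
      simp only [Matrix.trace_sub, Matrix.trace_smul, Matrix.trace_one, Fintype.card_fin,
        smul_eq_mul]
      linarith
    have hHerm : (H - s • (1 : Matrix (Fin d) (Fin d) ℝ)).IsHermitian := by
      refine hH.sub ?_
      ext a b
      simp [Matrix.one_apply, eq_comm]
    have hα : ∀ᶠ δ : ℝ in 𝓝[>] 0, 0 < 1 + δ * (η - s) :=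
      nhdsWithin_le_nhds ((Continuous.continuousAt (by fun_prop)).eventually
        (lt_mem_nhds (by simp)))
    obtain ⟨δ, h1, h2, h3, h4⟩ := (hHerm.eventually_posDef_one_add_smul.and
      (hα.and ((eventually_ellE_subset hB hneg).and (eventually_one_lt_det_mul htrace)))).exists
    exact absurd (hmax _ _ _ h1 h2 h3) (not_le.2 h4)

/-- **John's condition for the symmetrized subgraph** (Theorem 1.1). -/
theorem john_condition_symmetrized_subgraph (d : ℕ) (hd : 1 ≤ d)
    (f : Ed d → ℝ) (hf : ProperLogConcave f)
    (hB : unitBallE d ⊆ {p : Ed d × ℝ | |p.2| ≤ f p.1 / 2}) :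
    (∀ (A : Matrix (Fin d) (Fin d) ℝ) (α : ℝ) (a : Ed d),
        A.PosDef → 0 < α → ellE A α a ⊆ {p : Ed d × ℝ | |p.2| ≤ f p.1 / 2} →
          volume (ellE A α a) ≤ volume (unitBallE d) ∧
            (volume (ellE A α a) = volume (unitBallE d) →
              A = 1 ∧ α = 1 ∧ a = 0)) ↔
      ∃ (k : ℕ) (u : Fin k → Ed d × ℝ) (c : Fin k → ℝ), 1 ≤ k ∧
        (∀ i, u i ∈ frontier (unitBallE d) ∩
            frontier {p : Ed d × ℝ | |p.2| ≤ f p.1 / 2}) ∧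
        (∀ i, 0 < c i) ∧
        (∑ i, c i • Matrix.vecMulVec (augVec (u i)) (augVec (u i))) =
          (1 : Matrix (Fin (d + 1)) (Fin (d + 1)) ℝ) ∧
        (∑ i, c i • (u i).1) = 0 := by
  constructor
  · intro hmax
    exact exists_john_decomposition_of_maximal hB fun A α a hA hα hE =>
      (volume_ellE_le_iff a hA.det_pos hα).1 (hmax A α a hA hα hE).1
  · rintro ⟨k, u, c, -, hu, hc, hI, h0⟩ A α a hA hα hE
    obtain ⟨hle, heq⟩ := hf.1.unitBallE_unique_maximal hB hu hc hI h0 hA hα hE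
    exact ⟨(volume_ellE_le_iff a hA.det_pos hα).2 hle,
      fun h => heq ((volume_ellE_eq_iff a hA.det_pos hα).1 h)⟩
end
end
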